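/- A(20,8) = 256. That is, the maximum cardinality of a binary code of length 20 in which any two distinct codewords have Hamming distance at least 8 is exactly 256 (so the quadruply shortened Golay code is optimal). -/

import Mathlib

/-- The certificate: for each `m`, a list of triples consisting of a degree, a nonnegative weight and
a list of vectors, which are indexed by half the arguments of `entry`. -/
def certificate : List (List (ℕ × ℕ × List (List (List ℤ)))) :=
  [[(0, 17592186044416, [[[1495632, 0, 0, 0, 31940, 18028, -42795, -112121, -83079, -93768,
  4770712]], [[278086, 0, 0, 0, -64183, -45755, 38373, 268971, 662912, -11256]], [[-21374, 0, 0,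
  0, 6215, 120322, -7296, -113801, 0, 15933]], [[905560, 0, 0, 0, -3661, 0, -3580, -5713, 0,
  -3142]]]), (1, 274877906944, [[[0, 0, 0, 0, -122589, -129824, -107984, -81125, -90590,
  990564]], [[0, 0, 0, 0, -126504, -139618, 61286, 383101, 586715]]]), (2, 1073741824, [[[0, 0,
  0, 0, -161123, -378460, -341542, -276542, -317316, 2988404]], [[0, 0, 0, 0, -465085, -98299,
  241405, 662597, 856731]]]), (3, 16777216, [[[0, 0, 0, 0, 195893, 553351, 361281, 704582,
  1740818]], [[0, 0, 0, 0, 256961, 244521, 212198, 184786]]]), (4, 1048576, [[[0, 0, 0, 0,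
  -175731, -137504, -182060, -149779, 2663343]]]), (7, 64, [[[0, 0, 0, 0, -257423, -56611,
  324071]]])], [(0, 1099511627776, [[[3237567, 0, 0, 0, 142569, 202950, 119763, 328767, 3242581,
  5677431]], [[1184693, 0, 0, 0, -113121, -146757, 64577, 728653, 3021824]], [[148052, 0, 0, 0,
  -89379, -167982, 100301, 611793]], [[215214, 0, 0, 0, 9156, 458809, 198119]], [[53441, 0, 0, 0,
  7517, 0, 167012]], [[813463, 0, 0, 0, -3395]]]), (1, 17179869184, [[[0, 0, 0, 0, 235270,
  -114488, 96827, 912590, 3071881, 649702]], [[0, 0, 0, 0, 539001, 522640, 174499, -177708, 0,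
  1754141]], [[0, 0, 0, 0, 196004, 256391, 334348, -46866]], [[0, 0, 0, 0, 2520, 7973, 0,
  47996]], [[0, 0, 0, 0, 21337, 22930]], [[0, 0, 0, 0, 7391]]]), (2, 67108864, [[[0, 0, 0, 0,
  -302236, 385051, 175571, 1110800, 8223891]], [[0, 0, 0, 0, 1557389, 668646, 773214, 740680]],
  [[0, 0, 0, 0, 0, 1020107, 876897, 281763]], [[0, 0, 0, 0, 0, 0, -496972, 785212]]]), (3,
  4194304, [[[0, 0, 0, 0, 791015, 933136, 905101, 868283, 1527876]], [[0, 0, 0, 0, 3907, 0, 2245,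
  -4293, 159354]], [[0, 0, 0, 0, 7176, 0, 5031, -5144]]]), (4, 65536, [[[0, 0, 0, 0, 506156,
  1008417, 536008, 901456]]]), (5, 1024, [[[0, 0, 0, 0, -8283, 905178, 16409, -173566]]]), (6,
  64, [[[0, 0, 0, 0, 122820, 1463313, -203541]], [[0, 0, 0, 0, -596913, 0, 1776068]]]), (7, 4,
  [[[0, 0, 0, 0, 2080892, 229533, -1891778]]])], [(0, 68719476736, [[[28096752, 0, 0, 0, 545792,
  382195, 29981, 702131, 4654259, 13777006], [0, 0, 0, 405840, 385358, 9011, 370458, 4730008,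
  4483128, 53815331]], [[5981944, 0, 0, 0, -360047, -584096, -235579, 272061, 12470963, 2484370],
  [0, 0, 0, 170169, -145397, 128234, 935802, 3011393, -201089]], [[6750201, 0, 0, 0, -328809,
  -175687, -246985, -63088, 0, 5659071], [0, 0, 0, -4742, 157588, -151158, 54524, 3895454,
  11455491]], [[2346067, 0, 0, 0, -677803, -145902, 52170, 335853, 0, 1700448], [0, 0, 0,
  -420842, -44765, 385592, 1170837, 4683652]], [[1289696, 0, 0, 0, -238176, 184580, -102521,
  -808827, 0, 3699788], [0, 0, 0, 226452, 682044, 363608, -137980]], [[272393, 0, 0, 0, 273453,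
  1363345, 768208, -948056], [0, 0, 0, -337675, 469194, 54657, -815809]], [[172233, 0, 0, 0,
  -331928, 0, -187068, 539192], [0, 0, 0, -405379, -207100, 83924, 1043265]], [[-113851, 0, 0, 0,
  -421580, 0, -612338, -421339], [0, 0, 0, 138526, 877119, 111761]], [[1052594, 0, 0, 0, -7310,
  0, -5430, -5560], [0, 0, 0, -6940, 0, -2817]], [[0, 0, 0, 0, -1638, 0, -958, 15150], [0, 0, 0,
  -5279, 0, -4614]]]), (1, 1073741824, [[[0, 0, 0, 0, -88049, -844052, -492599, 508132, 6018993],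
  [0, 0, 0, 280994, 175408, 887240, 2582725, 10913364, 5927957]], [[0, 0, 0, 0, 729523, 127104,
  203071, 1704145, 12841267], [0, 0, 0, 259442, -775121, -532553, 5, 0, 1117171]], [[0, 0, 0, 0,
  -645292, -940371, -486429, 335239], [0, 0, 0, -522214, 165203, 1043640, 2239522, 0, 592233]],
  [[0, 0, 0, 0, -930669, -1641767, -1801414, -1160225], [0, 0, 0, -324407, -62500, -219245, 0, 0,
  3068328]], [[0, 0, 0, 0, -849987, -799721, -117621, 1827740], [0, 0, 0, -805837, -1104122,
  -783907]], [[0, 0, 0, 0, 265329, 41567, 39553], [0, 0, 0, 314426, 217388, -108703]], [[0, 0, 0,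
  0, 46092, 125164, 109054], [0, 0, 0, 0, 10789, 61163]], [[0, 0, 0, 0, 12117, 0, -1276], [0, 0,
  0, 0, -1683, -7793]]]), (2, 16777216, [[[0, 0, 0, 0, -14472, 188263, 203041, 4672800,
  17186619], [0, 0, 0, 497084, 1100034, 1438915, 3605523, 12837357, 20183522]], [[0, 0, 0, 0,
  1302829, 925195, 1061235, 503258, 7952697], [0, 0, 0, 786112, 587045, 172986, -236118, 0,
  14011341]], [[0, 0, 0, 0, 1059195, -696789, -91658, -344167, 8963982], [0, 0, 0, 1687890,
  737517, 530843, 854873]], [[0, 0, 0, 0, -1585450, -1044322, -83408, -234301], [0, 0, 0, 941774,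
  1789753, 1954817, 2534931]], [[0, 0, 0, 0, 368719, 1430862, 923403, -1053264], [0, 0, 0,
  -360074, 715779, 892826]], [[0, 0, 0, 0, -324955, 0, -545760, 846088], [0, 0, 0, -389205,
  -360040, -302027]], [[0, 0, 0, 0, 1868, 0, 36742], [0, 0, 0, 16841, 18445, 7925]], [[0, 0, 0,
  0, 19066], [0, 0, 0, 11661, -458, -1712]]]), (3, 262144, [[[0, 0, 0, 0, 706121, 444999,
  -318567, 520240], [0, 0, 0, 2707098, 3196842, 1842398, 1685132, -297006]], [[0, 0, 0, 0,
  2779467, 2509574, 2368708, 2221650], [0, 0, 0, 807411, 0, 543183, -419769, -793914]], [[0, 0,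
  0, 0, 0, 381881, 1856866, -1037337], [0, 0, 0, -350429, 0, 1433134, 2218790, -1432496]], [[0,
  0, 0, 0, 0, -183, 146, -303], [0, 0, 0, 189, 0, 165, 0, 73142]]]), (4, 16384, [[[0, 0, 0, 0,
  770536, 698915, 407229, 6193191], [0, 0, 0, 466359, 1016475, 736007, 483948, 22584693]], [[0,
  0, 0, 0, -298440, -210658, 928135, 112555], [0, 0, 0, 1123762, -378282, -406318, 1190754]],
  [[0, 0, 0, 0, 3023, 3028, 116, 27603], [0, 0, 0, -206, 4054, 3327]]]), (5, 256, [[[0, 0, 0, 0,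
  1178057, 388118, 1739892], [0, 0, 0, -2294751, 2414865, -1596906, 283734]], [[0, 0, 0, 0,
  1036827, -586554, -1336020], [0, 0, 0, 191214, 0, -955243, 3797858]]]), (6, 16, [[[0, 0, 0, 0,
  1283507, 292354, 4768046], [0, 0, 0, 6104815, 1083290, 1261248, 6943093]], [[0, 0, 0, 0,
  -541887, 41062, 2274639], [0, 0, 0, 880750, 1091996, 240650]]]), (8, 1, [[[0, 0, 0, 0, 1213273,
  60429], [0, 0, 0, 0, 1952975, 1388125]]])], [(0, 17179869184, [[[8215859, 0, 0, 0, 383889,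
  322877, 199111, 341124, -3994239], [0, 0, 0, 417308, 488779, 50923, 854266, 8564817,
  17019233]], [[4508008, 0, 0, 0, 291155, 66459, -177614, 1784372, 10125806], [0, 0, 0, -252986,
  -403278, -479673, 484288, 2086552]], [[2147180, 0, 0, 0, -968332, -837089, 72915, 316744], [0,
  0, 0, -541714, -357165, 839628, 2632398, 5284555]], [[1202477, 0, 0, 0, 536452, 657100,
  1450388, 2609905], [0, 0, 0, -474175, -444548, -152512, -572696]], [[1781548, 0, 0, 0, 1560243,
  2438134, 1888242], [0, 0, 0, -452364, 254494, -109426, -231753]], [[-217657, 0, 0, 0, 1611299,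
  0, 82582], [0, 0, 0, -201125, -1441098, -835781, 132798]], [[300376, 0, 0, 0, 0, 0, 749200],
  [0, 0, 0, 930729, 7073, -228881, -544350]], [[862166, 0, 0, 0, 0, 0, 4434], [0, 0, 0, 0, -4788,
  -5198, -5528]], [[0, 0, 0, 0, 0, 0, 33973], [0, 0, 0, 0, -18325, 6211, 22568]], [[], [0, 0, 0,
  0, -2967, -1218, 10854]]]), (1, 268435456, [[[0, 0, 0, 0, -841419, -336272, 472775, 4382196,
  33327716], [0, 0, 0, -100455, -900927, -628412, 715902, 4945192, 2099847]], [[0, 0, 0, 0,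
  709645, -331122, -219707, 636824], [0, 0, 0, -304585, -388625, 285747, 2446863, 15656705,
  29388139]], [[0, 0, 0, 0, -734410, -968257, -615129, -2441352], [0, 0, 0, 177572, 277583,
  264698, 92170, 5657835]], [[0, 0, 0, 0, 3481814, 2677998, 2078816, 1762548], [0, 0, 0, -339641,
  -880198, -1362889, -1509756]], [[0, 0, 0, 0, 0, -1163359, -1012011, 1511836], [0, 0, 0,
  -1363466, -1285575, 77243, 2862601]], [[0, 0, 0, 0, 0, 1205123, 2498192, 564187], [0, 0, 0,
  -1004484, -369291, 43190]], [[0, 0, 0, 0, 0, 660838, 0, 1411095], [0, 0, 0, 2152, 207225,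
  25877]], [[0, 0, 0, 0, 0, -14962], [0, 0, 0, 21866, 6306, 4818]], [[0, 0, 0, 0, 0, 14722], [0,
  0, 0, 0, 10269, 6374]]]), (2, 4194304, [[[0, 0, 0, 0, -164858, 222350, 3001023, 9735374], [0,
  0, 0, -644, 448926, 1846638, 5434938, 17084014]], [[0, 0, 0, 0, 2294811, 3627158, 4135443,
  2476789], [0, 0, 0, -1271572, -221428, -285081, -67914]], [[0, 0, 0, 0, 2401986, 0, -112563,
  1532170], [0, 0, 0, 657293, -1484047, -1774880, -1662399]], [[0, 0, 0, 0, 0, 0, -1016997,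
  1542976], [0, 0, 0, -1562722, -118947, 1113085, 2229855]], [[0, 0, 0, 0, 0, 0, -1096, -30087],
  [0, 0, 0, 17758, 25258, 15034]], [[0, 0, 0, 0, 0, 0, 14666, 36571], [0, 0, 0, 10422, 0,
  -4850]], [[0, 0, 0, 0, 0, 0, 17621], [0, 0, 0, 6771, 0, -2725]]]), (3, 65536, [[[0, 0, 0, 0,
  -1476684, -130892, 1666210, 1939586], [0, 0, 0, -2085704, -379975, 1931754, 2659947,
  18142611]], [[0, 0, 0, 0, 3527967, 2926146, 3430705, 8406165], [0, 0, 0, 820798, 426572,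
  1199679, 718521]], [[0, 0, 0, 0, 0, 562891, 2708551, 2703334], [0, 0, 0, -1992188, -1253607,
  -533787, 659375]], [[0, 0, 0, 0, 0, 3692, 0, 24111], [0, 0, 0, 5994, 11308, 27983, 20171]],
  [[0, 0, 0, 0, 0, -1173, 0, -9549], [0, 0, 0, 18394, 10594, 0, 1514]], [[0, 0, 0, 0, 0, -1817,
  0, 44849], [0, 0, 0, 0, -511, 0, -734]]]), (4, 4096, [[[0, 0, 0, 0, -309961, -566602, 4373564],
  [0, 0, 0, -618934, -22326, -35965, -780956]], [[0, 0, 0, 0, 1434721, 785889], [0, 0, 0,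
  1254825, 872523, 1137146, 1413311]]]), (5, 256, [[[0, 0, 0, 0, 1040283, -392428, 7528914], [0,
  0, 0, -396998, 357868, -267371, 622296]], [[0, 0, 0, 0, 1861514, -1684166], [0, 0, 0, -459137,
  -109408, -199113, 2161680]]]), (6, 16, [[[0, 0, 0, 0, -1352739, -525699], [0, 0, 0, 3414789,
  139117, 924172]]]), (7, 1, [[[0, 0, 0, 0, -1931545, 1079108], [0, 0, 0, 0, 536888, 4533236]]]),
  (8, 1, [[[0, 0, 0, 0, 9201], [0, 0, 0, 0, 2936]]])], [(0, 4294967296, [[[45303654, 0, 0, 0,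
  -983960, -934934, -2438816, 4229604, 87157771], [0, 0, 0, -427075, -309122, -698771, -2623551,
  -1433378, 3844217], [0, 0, 867357, 727901, -593797, -906553, 2281758, 4475021, 43677385]],
  [[2391696, 0, 0, 0, -1623328, -2121562, -701826, -366249], [0, 0, 0, 890656, 418962, -212172,
  -521867, 971423, -1001132], [0, 0, -469374, -549608, -795632, -655335, 1437585, 9745988,
  2729354]], [[3111049, 0, 0, 0, 1996624, 368002, -524891, -470277], [0, 0, 0, 629185, -782696,
  -1207777, -759121, 42301, 1230755], [0, 0, 1816490, -47679, -474539, -270793, -1398650, 0,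
  9186420]], [[4425988, 0, 0, 0, 420103, -162663, 1771612, 5305878], [0, 0, 0, -393937, -756325,
  313020, 1639154, 7455954, -495591], [0, 0, -280472, -1105645, -283558, 429579, -578138]],
  [[2543344, 0, 0, 0, 2140806, 3913864, 3750366, 1358778], [0, 0, 0, 19341, -223378, -542853,
  -1276198, 0, 914772], [0, 0, -1972019, -1089682, -509191, 140538, 1007448]], [[2039917, 0, 0,
  0, 1686357, 0, 262696, 675561], [0, 0, 0, -489227, -13798, -176184, -280670, 0, 3092074], [0,
  0, -818654, 551945, 317510, 354487, 959755]], [[-118519, 0, 0, 0, 367536, 0, -734030, 2753357],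
  [0, 0, 0, -372623, -168550, 398711, 1390794], [0, 0, -2466652, -1294264, -28335, 330487,
  -532750]], [[-16058, 0, 0, 0, 16159, 0, 47802], [0, 0, 0, 11426, -14134, -14817, -18773], [0,
  0, 104972, 21180, -21269, -28497, -26061]], [[834533, 0, 0, 0, 2168, 0, 4686], [0, 0, 0, -3214,
  -4290, -5150, -6610], [0, 0, 0, -1685, -4173, -3552, -216]], [[0, 0, 0, 0, 13879, 0, 42043],
  [0, 0, 0, 3145, 5065, -9158, -28615], [0, 0, 0, 14668, -2823, 456, 56755]], [[0, 0, 0, 0,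
  47931, 0, -5854], [0, 0, 0, -12926, -2592, -4711, -5439], [0, 0, 0, 18890, 6232, 1701]], [[0,
  0, 0, 0, 0, 0, -23146], [0, 0, 0, -13161, -3509, 4785, 13625], [0, 0, 0, 17035, 31768, 33479]],
  [[0, 0, 0, 0, 0, 0, -9189], [0, 0, 0, -7670, -1840, 7705, 15875], [0, 0, 0, -2416, 160]], [[0,
  0, 0, 0, 0, 0, -2506], [0, 0, 0, -2110, 2613, 702], [0, 0, 0, 9218, 4797]], [[0, 0, 0, 0, 0, 0,
  8549], [0, 0, 0, -324, 835, 574], [0, 0, 0, 0, -1440]]]), (1, 67108864, [[[0, 0, 0, 0, 1577566,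
  1093926, -198091, -3852311], [0, 0, 0, -235927, -1260527, -913198, 328969, 1856333], [0, 0,
  -1212651, 1732934, 3774971, 6999693, 10821693, 10389508]], [[0, 0, 0, 0, -1012073, -1663180,
  -1763771, 13577797], [0, 0, 0, 311224, -931639, -247846, 2160511, 1965691], [0, 0, 971384,
  -554930, -1670474, -923953, 0, 4128853]], [[0, 0, 0, 0, 1029844, 1000463, -354841], [0, 0, 0,
  6777, -254863, -701389, 484631, 11874591], [0, 0, 2262936, 1505059, 124775, -659712, 0,
  3640418]], [[0, 0, 0, 0, -2599429, -645960, 172861], [0, 0, 0, 39418, 354265, 358430,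
  -1510061], [0, 0, 5140603, 5113521, 2257349, 634097, 0, -6305554]], [[0, 0, 0, 0, 2683602,
  4599119, 1993178], [0, 0, 0, -694146, -756687, -351675, -630950], [0, 0, 1608575, 0, 582149,
  1897712, 0, -938902]], [[0, 0, 0, 0, -718057, 0, 3818805], [0, 0, 0, -479575, -523366, -44871,
  1860337], [0, 0, 396951, 0, -703019, -547494, 0, 882520]], [[0, 0, 0, 0, -433359], [0, 0, 0,
  -559174, -216620, -533843, 98614], [0, 0, 458053, 0, 2492573, 1422033, 0, -862381]], [[0, 0, 0,
  0, -23117], [0, 0, 0, -948878, -860529, -482599, 1164585], [0, 0, -1567242, 0, 0, 1391506, 0,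
  2136876]], [[0, 0, 0, 0, -10771], [0, 0, 0, -60170, -47855, -16139, 83489], [0, 0, -95542, 0,
  0, 90714]], [[0, 0, 0, 0, -10444], [0, 0, 0, 5193, 14630, 25411, 14659], [0, 0, 6109]], [[0, 0,
  0, 0, -7585], [0, 0, 0, -6680, -4214, 0, 23704], [0, 0, 7646]], [[0, 0, 0, 0, -9160], [0, 0, 0,
  -493, -2528], [0, 0, 20382]], [[0, 0, 0, 0, 9812], [0, 0, 0, 3472, 2328]]]), (2, 1048576, [[[0,
  0, 0, 0, 1226230, -451740, 1387671, -2213059], [0, 0, 0, -532504, -1371695, -1232657, -327033,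
  21131262], [0, 0, 2880514, 4210618, 3540233, 5463785, 3951787, 8802306]], [[0, 0, 0, 0,
  6624290, 3221999, 4916690, 9874636], [0, 0, 0, 964690, 71067, -306151, -1306920], [0, 0,
  -3761535, -4714239, -4055791, -3895106, -4095213, 2481133]], [[0, 0, 0, 0, 0, -2045900, 115532,
  9099019], [0, 0, 0, 624123, -426541, 1617045, 3870036], [0, 0, -1290400, -2500366, -435392,
  2992813, 2316518, 12023736]], [[0, 0, 0, 0, 0, 1918521, 2694839, -3827098], [0, 0, 0, -2000097,
  -354157, 1055297, 2631803], [0, 0, -2500908, -691684, 821869, 2330022, 3517852]], [[0, 0, 0, 0,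
  0, -965626, -1027558, -2390472], [0, 0, 0, 177053, 213864, -673256, -1726385], [0, 0, 486358,
  2079049, 519881, 344477]], [[0, 0, 0, 0, 0, 100297, 67213, -190854], [0, 0, 0, -47307, -1957,
  -3309, -2222], [0, 0, -12661, 0, 14014, -36860]], [[0, 0, 0, 0, 0, 0, 8875, 119407], [0, 0, 0,
  8215, -3279, 4857, 14855], [0, 0, 18391, 0, 3622, 4471]], [[0, 0, 0, 0, 0, 0, -2491], [0, 0, 0,
  7281, -8935, -7932, 1196], [0, 0, 36940, 0, 10189, 5077]], [[0, 0, 0, 0, 0, 0, 9531], [0, 0, 0,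
  -5189, -5778, 4063, 18502], [0, 0, 0, 0, 8077, 24683]], [[0, 0, 0, 0, 0, 0, 13454], [0, 0, 0,
  57, -673, 3303, 6780], [0, 0, 0, 0, -533]]]), (3, 16384, [[[0, 0, 0, 0, 669367, 4651996,
  7122841], [0, 0, 0, -1999500, 1310947, 3869121, 7811638], [0, 0, -5923517, -1635463, 1293760,
  4118875, 19101804]], [[0, 0, 0, 0, 455742, 392998, 283095], [0, 0, 0, 577774, 527850, 267147,
  249553], [0, 0, 1475138, 167071, 374258, 287107]], [[0, 0, 0, 0, 16165, 26477, 20970], [0, 0,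
  0, 6292, 12580, 13233, 20765], [0, 0, 0, -8357, 3956, 6966]], [[0, 0, 0, 0, -3521, 0, 8845],
  [0, 0, 0, -680, 3875, 6528, 12203], [0, 0, 0, 5925, 9074, 15093]], [[0, 0, 0, 0, -199, 0,
  -653], [0, 0, 0, 1472, 21, -550, -1907], [0, 0, 0, 12167, 1215]]]), (4, 1024, [[[0, 0, 0, 0,
  -1520, -1599, -3405], [0, 0, 0, -1520, -1658, -1572, -1407], [0, 0, -8216, -719, -1517, -1867,
  68723]]]), (5, 64, [[[0, 0, 0, 0, 11, -254], [0, 0, 0, -66, -69, 81], [0, 0, 0, 13226, -17,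
  -236]]])]]

/-- The possible sizes of the intersections of a set with the four atoms generated by two sets. -/
def splitList : List (ℕ × ℕ × ℕ × ℕ) :=
  [(0, 0, 0, 0), (1, 0, 0, 0), (2, 0, 0, 0), (3, 0, 0, 0), (4, 0, 0, 0), (0, 2, 0, 0), (1, 2, 0,
  0), (2, 2, 0, 0), (0, 4, 0, 0), (0, 0, 2, 0), (1, 0, 2, 0), (2, 0, 2, 0), (0, 2, 2, 0), (0, 0,
  4, 0), (0, 1, 1, 1), (1, 1, 1, 1), (0, 0, 0, 2), (1, 0, 0, 2), (2, 0, 0, 2), (0, 2, 0, 2), (0,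
  0, 2, 2), (0, 0, 0, 4)]

set_option maxRecDepth 100000 in
/-- The values of `splitWeight` on `splitList`. -/
def kernelTable : List (List (List (List ℤ))) :=
  [[[[55146976151663521233371136, 13873804885823677202956288, 60415996876336206924742656,
  1682487328744389692358656, 9014062102129291282087936, 0, 0, 0, 0, 0, 0, 0, 0, 0, 0, 0, 0, 0, 0,
  0, 0, 0]], [], [], [], [[465735494144478677041152, 345181561746338776875008,
  626855584120850329108480, 93824975213742369275904, -135487751306968964268032,
  790863062564417960935424, 1239965930829920600064, -76929345933006065369088,
  155421190324079481061376, 0, 0, 0, 0, 0, 0, 0, 0, 0, 0, 0, 0, 0]], [[205259756922265936068608,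
  612509649616500619739136, 434692462159836070543360, 108039545661797714362368,
  -159132092439680964886528, 810077882992242886443008, 28541903806249918529536,
  -83169756981703743635456, 107916683919562761043968, 0, 0, 0, 0, 0, 0, 0, 0, 0, 0, 0, 0, 0]],
  [[-992560591687077779734528, 583464301504516369416192, -137634237660534881124352,
  108416762702088021999616, -411428534132916417986560, 95323769555911427751936,
  -3621846984702027628544, -156026449211717563973632, -138223036918818087632896, 0, 0, 0, 0, 0,
  0, 0, 0, 0, 0, 0, 0, 0]], [[-1682442217386369248919552, 2219048084304160310165504,
  1412235449219998636048384, 251943589949411162062848, 933162650696378843398144,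
  1298867067875040281231360, 232876949572315682701312, -511959178335870687117312,
  -174117026899544164532224, 0, 0, 0, 0, 0, 0, 0, 0, 0, 0, 0, 0, 0]],
  [[1057130916969370735345664, 15478932370926365713629184, 14112930149462429652746240,
  220436791597277326082048, 16958959692029392022667264, 12932669133344516138336256,
  1565436770970410623696896, -126625724951102266277888, 448753762202935392993280, 0, 0, 0, 0, 0,
  0, 0, 0, 0, 0, 0, 0, 0]], [[-2578282267167571799179264, 20210192774675628715671552,
  30848950773877474561359872, 0, 0, 13887196021661462708617216, 2402220196135648570114048,
  781822719298803244990464, 970852633463589879939072, 0, 0, 0, 0, 0, 0, 0, 0, 0, 0, 0, 0, 0]],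
  [[125524285361089459827769344, 0, 0, 0, 0, 103906323337935389020127232, 0, 0,
  8649429876840371463389184, 0, 0, 0, 0, 0, 0, 0, 0, 0, 0, 0, 0, 0]]], [], [], [], [[], [], [],
  [], [[247941471213566850760704, -115489522736485708333056, -14630036482032723542016,
  -111424065022034229526528, 131252359508728594825216, -57179396414272016138240,
  -12744535516510015471616, 13700491550981540937728, -6304139611229590126592,
  -57179396414272016138240, -12744535516510015471616, 13700491550981540937728,
  7452401190347476500480, -6304139611229590126592, 0, 0, 0, 0, 0, 0, 0, 0],
  [14478043918395527954432, -71721190262752043565056, 45544578816556606715904,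
  -19265872252333306903296, 82747443078482997657600, -16541465504290366277632,
  -4517658187751634427904, 4575886530002288410624, -3547741350569286696960,
  -16541465504290366277632, -4517658187751634427904, 4575886530002288410624,
  6447259714143228657664, -3547741350569286696960, 11509395308583024005120,
  7452401190347476500480, 0, 0, 0, 0, 0, 0], [-78511899061430890397696, -77286330087991652761600,
  60702486302153617932288, 22817044361493600595456, 53807570447233643085824,
  10202750417479325175808, -4026426717351540580352, -1560361266886890946560,
  -9502545724854532833280, 10202750417479325175808, -4026426717351540580352,
  -1560361266886890946560, 6684988389750955114496, -9502545724854532833280,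
  19555239216731979526144, 6447259714143228657664, 46161632538668529995776,
  11509395308583024005120, 7452401190347476500480, 5389503840138316218368,
  5389503840138316218368, 0], [-30833707727071190876160, -34323498975797129330688,
  58955807359846708494336, 61379805860404196438528, 44573585444782766276608,
  25817425630008770836480, -11066729175864475688960, -4939047058781539139584,
  -24875489927616590643200, 25817425630008770836480, -11066729175864475688960,
  -4939047058781539139584, 9095620208427347312640, -24875489927616590643200,
  27539873913810057375744, 6684988389750955114496, 37356777276481833875456,
  19555239216731979526144, 6447259714143228657664, 7642994634022342098944,
  7642994634022342098944, 0], [152801245404515564257280, 58421121350898143887360,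
  87039343543470610833408, 113445642245596267702272, 55186332875107464118272,
  65621281878584377032704, -22969788686488978202624, -5790965089895786283008,
  -50373505885760460423168, 65621281878584377032704, -22969788686488978202624,
  -5790965089895786283008, 14609189134190858076160, -50373505885760460423168,
  40620108973655073038336, 9095620208427347312640, 31768834850003748995072,
  27539873913810057375744, 6684988389750955114496, 7692230431432132001792,
  7692230431432132001792, 26431382322569796386816], [555207709822530877456384,
  311267572197478938312704, 177663267322132437018624, 188813106764215699086592,
  85786658516448013991936, 139725016324872843243520, -25444009975360013582336,
  -4346908630092263227392, 0, 139725016324872843243520, -25444009975360013582336,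
  -4346908630092263227392, 24155730107001177374720, 0, 70990972029940326080512,
  14609189134190858076160, 59810382707482829860864, 40620108973655073038336,
  9095620208427347312640, 8263068397977504579584, 8263068397977504579584,
  60975517211401334685696], [1254294412500375975493632, 754859294614447189622784,
  383978788582739454296064, 301369472785284209836544, 136515409121396192542720,
  280000897125735682367488, -18819399298581129641984, -837669975412014186496, 0,
  280000897125735682367488, -18819399298581129641984, -837669975412014186496,
  38665279045938708086784, 0, 126866676707139398000640, 24155730107001177374720,
  170351599257018058760192, 70990972029940326080512, 14609189134190858076160,
  12081370965894540296192, 12081370965894540296192, 106331155411560061468672],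
  [2415496202417612649857024, 1511987080125420180766720, 782442043311706404077568,
  500682338264099024833536, 207513432416983594450944, 0, 0, 0, 0, 0, 0, 0, 0, 0,
  290830136988448105816064, 38665279045938708086784, 402166420886975651803136,
  126866676707139398000640, 24155730107001177374720, 0, 0, 170498741849512419393536],
  [4938799062213689139527680, 4084963240748387004710912, 1740220465186308923867136,
  955147656114812554928128, 298921577104769951203328, 0, 0, 0, 0, 0, 0, 0, 0, 0, 0, 0,
  1296873122522819366404096, 290830136988448105816064, 38665279045938708086784, 0, 0,
  261478749919225750487040]], [[-589205189749344436224000, -511573796355736851972096,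
  -319926504419433125494784, 0, 0, -129656537765441948237824, -38917527705833808527360,
  -1973259951752607956992, -27741286157887841107968, -258527352588166958268416,
  -64701547424965937324032, 18597372345539052044288, -196474093829088215040,
  -48951557597366127165440, 0, 0, 0, 0, 0, 0, 0, 0], [-364263999901548726583296,
  -287028913057480703950848, -171893054623891199123456, 2930313537186258309120, 0,
  -61059538263543158544384, -25016942165243518318592, -2796486748218343309312,
  -8701821847079768981504, -139570737405800933875712, -32759312319028827561984,
  8072329209993031057408, -1078859187446504718336, -39689098373844985970688,
  -29460797250377310814208, -196474093829088215040, 0, 0, 0, 0, 0, 0],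
  [-209687730834968222367744, -126452345431805802479616, -61845517316024320081920,
  -6344073964928009592832, 32573388289390626865152, -21152233671242868178944,
  -16473352943351953485824, -4873400085444893704192, -704125524513250410496,
  -59438002549279107088384, -16741193361596244303872, 1887765650578010406912,
  -403408758179749625856, -29772699871461127487488, -9344154585577223741440,
  -1078859187446504718336, 11326348316709510217728, -29460797250377310814208,
  -196474093829088215040, -7003891086788989747200, -8080632023905426472960, 0],
  [-84804585361325171343360, -18107820870123080294400, -138217347827570948096,
  23576779474767255694336, 31409693088602520518656, -4703874838284108980224,
  -17435025733647704846336, -7963917220614117670912, -3966917574074293026816,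
  -19809327282309829701632, -9103492413757189156864, -1904564861842896093184,
  1332600316850174164992, -24994100388666676084736, 6577376178022518202368,
  -403408758179749625856, 27337277866933612228608, -9344154585577223741440,
  -1078859187446504718336, -1284664022894751121408, -5700399545679576694784, 0],
  [31586159433304359567360, 42032060703719673200640, 34284041402489305931776,
  54710884760835575500800, 37987572995576435769344, 994845530353374437376,
  -28380065522374035881984, -11827954346987515543552, -18708918024946283380736,
  -1535680075436400582656, -12392833550492263526400, -5252907849768684683264,
  3631892220010625433600, -31145032683561524133888, 17917255549857279533056,
  1332600316850174164992, 20321132541157762473984, 6577376178022518202368,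
  -403408758179749625856, 564646777090108751872, -2999855960302626013184,
  -4724571259234560770048], [208971321433050671677440, 109336930191362710953984,
  73518537560265895489536, 91003634507953662851072, 53014111713626579533824,
  -7441068170502693709824, -48677976049373833164800, -16225426594460229025792,
  -45148846445418708041728, 11761857966886658822144, -25011149292568891707392,
  -10105507816824297357312, 5997192196481322024960, 0, 28074757581933000777728,
  3631892220010625433600, 3933151414620136452096, 17917255549857279533056,
  1332600316850174164992, -733164170325353005056, -1479034244545948811264,
  8236303658576158654464], [551572379643338397057024, 272300627856490593533952,
  157161281650643700834304, 148299244686002879795200, 77196393973098655842304,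
  1863334528639990562816, -73638873446605805883392, -20916248030115040755712,
  -83505421836695874699264, 36010447817649427283968, -40738751303790608257024,
  -18410608235524457562112, 7931226557578338238464, 0, 42238888319322304561152,
  5997192196481322024960, 43146449227259417493504, 28074757581933000777728,
  3631892220010625433600, -4455301569164342591488, -2637961630400431259648,
  35554455047775325257728], [1184794040341974461054976, 640332581416069549768704,
  330837815357509871380480, 240245593440706800749568, 111241505529330505121792,
  63425655799481324077056, -94743889925325866246144, -25660331658776373870592, 0, 0, 0, 0, 0, 0,
  69033139474936587304960, 7931226557578338238464, 172923206929389394649088,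
  42238888319322304561152, 5997192196481322024960, -9878969981130002923520, 0,
  79362702862716198977536], [2322981406323708269690880, 1420837108062315661885440,
  651724806646397890412544, 362660371217594899767296, 155856533160612743479296,
  574513271897538793291776, -111748327120369811849216, -30217589423564291571712, 0, 0, 0, 0, 0,
  0, 0, 0, 424703140876571804418048, 69033139474936587304960, 7931226557578338238464,
  -16281374462753087029248, 0, 141793869549004857016320]], [[-70519071329282413297664, 0, 0, 0,
  0, 99307301971332051058688, 0, 0, -87368063012000136167424, 331497226465148651634688, 0, 0,
  -52484929767362199552, -64200359866848810369024, 0, 0, 0, 0, 0, 0, 0, 0],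
  [-687541854743000747409408, -370562509296471133732864, 0, 0, 0, -139644080219609247563776,
  -22813523657488724996096, 0, -48281839323349251997696, -61751413751418856620032,
  -1279134278164606746624, 0, -5091524410564419780608, -56872523673991647592448,
  -11912662975761512038400, -52484929767362199552, 0, 0, 0, 0, 0, 0], [-393940162637513070739456,
  -191681334927053227327488, -150351911823400231165952, 0, 0, -73274109211551619055616,
  -26078514326588484984832, -7711433015023373844480, -19783586870233194266624,
  -50543848208899566239744, -4533343478923898126336, 10566742369809534550016,
  -6168286368497016045568, -44235345430787334602752, -18871470573132555681792,
  -5091524410564419780608, 11432005735224150425600, -11912662975761512038400,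
  -52484929767362199552, -6325461890076561244160, -15875168377372003008512, 0],
  [-164377403830246577733632, -62725530222205104177152, -48181988570409545363456,
  7211096361327985360896, 0, -24714014641207592630272, -20723027717427568862208,
  -6018875265039513829376, -1650754900159075270656, -40037536586957429424128,
  -5068379742595286695936, 3668098656546716647424, -4910571499720314667008,
  -35257686678802058969088, -10217639264300763480064, -6168286368497016045568,
  26409535632290310963200, -18871470573132555681792, -5091524410564419780608,
  -2290536565650846220288, -15111773152504420237312, 0], [-58681490064827303854080,
  -38089256143838515757056, 5598813785485715554304, 29175410358405735645184,
  65618668069810369200128, -10787548917753136390144, -26489362021526149173248,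
  -7049568437043255083008, 6339208312067415080960, -24933673707122644680704,
  -8909326437584460054528, 139491809414013255680, -2946179486851776610304,
  -38908397161666204663808, -3376768199745564901376, -4910571499720314667008,
  7374638453672083521536, -10217639264300763480064, -6168286368497016045568,
  -594376791546151501824, -11182527186505933258752, 1445080136355528310784],
  [-36387602398056427454464, -18891954212526683627520, 29094850827576254261248,
  41045442159187838074880, 47333530655323838349312, -28808333641427646676992,
  -43404872549644359731200, -10221300945743310225408, 4408855464205516619776,
  -8291794810126829330432, -17444609069925483610112, -3041661552047105769472,
  -1902909002873244024832, 0, -644698024030658838528, -2946179486851776610304,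
  -20504797689243961925632, -3376768199745564901376, -4910571499720314667008,
  -1745945661552406298624, -8923401279418118438912, -7746270523638785114112],
  [-73101443540906884333568, 23473247908394022486016, 63983398167766789451776,
  69051647765711494643712, 43090097194870929620992, -51133604867953764007936,
  -73269530474553054990336, -14951860198814162321408, -7219259773557093728256,
  22470483853322784882688, -41606825572132676829184, -8897942625619608076288,
  -3408557715033024135168, 0, -5526275168426998005760, -1902909002873244024832,
  -17437195132576862224384, -644698024030658838528, -2946179486851776610304,
  -6254205297850058604544, -13170360784482234007552, -4747257199680732004352],
  [-44135985517526753181696, 205938430529986027937792, 136943071697037632595968,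
  115579014261879535796224, 53939758565302449078272, -66297731617184375597056,
  -106685566539833535767552, -20659032596245717565440, -28322582758740794589184, 0, 0, 0, 0, 0,
  -14887582715632740810752, -3408557715033024135168, 26309429029132247490560,
  -5526275168426998005760, -1902909002873244024832, -14628116850191119319040, 0,
  8915301500899203350528], [159125277993764129865728, 588137445737469501308928,
  290643024938045337616384, 196326130326102036709376, 80933907826144765280256,
  -53784382826507684462592, -149027866662427120672768, -26760603529692957966336,
  -58678557876710512787456, 0, 0, 0, 0, 0, 0, 0, 158332031460408738775040,
  -14887582715632740810752, -3408557715033024135168, -27376640495080206368768, 0,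
  31714592227002141376512]], [[], [], [-1112247844810296936890368, 0, 0, 0, 0,
  -159771732460779596685312, 0, 0, -70989624937127428751360, 75576758769964811288576, 0, 0,
  -1272548041883452964864, -78354301003210271227904, 32539994545695366840320, 0,
  660689394753085214638080, 0, 0, 1763488649914007945216, 12887322801527785521152, 0],
  [-474184247015646269800448, -224969998593681093558272, 0, 0, 0, -95440648010694042685440,
  -19437634350539425972224, 0, -32733836716882594693120, 37291298360531935821824,
  -3141979539926300491776, 0, -3431733097392003612672, -42966083705342659657728,
  6128448645581680148480, -1272548041883452964864, 134957687858434151583744,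
  32539994545695366840320, 0, 1599140063028805894144, -6746946086565998886912, 0],
  [-160997432903486712840192, -142538242872758038953984, -42600904972764136341504, 0, 0,
  -67799368460484956897280, -20717063286435606953984, -6754122335652790927360,
  -4130864427569698701312, 12441294425729058996224, -11828154227524976508928,
  -27553025998270108794880, -3028587968324649877504, -28209244458080159137792,
  -3633542620034627534848, -3431733097392003612672, 59259850844824409776128,
  6128448645581680148480, -1272548041883452964864, 1916569498851906158592,
  -13672922853111850336256, 36754182455915229216768], [-154229819439810460254208,
  -116261436998297833701376, -10246288475891086393344, 4684027021944782061568, 0,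
  -78001585777361937672192, -29322106995668977451008, -212070939124498563072,
  15439320228332468961280, -9255745739573707669504, -27813666559508385628160,
  -28728301187856911564800, -3385546936252133015552, 0, -14890097220938946838528,
  -3028587968324649877504, -14737757553989914472448, -3633542620034627534848,
  -3431733097392003612672, 983226774093856440320, -17746066813397435023360,
  5113983267294225104896], [-397588394744275464617984, -114178790690550252044288,
  3882358968472945295360, 18293954968170809786368, 40596342674117044994048,
  -111959010078188100612096, -45208238777587533742080, 1193534544133836242944,
  26596746747025647337472, 752698136738130821120, -53815729274076436365312,
  -19499226765778852249600, -7825043380829036740608, 0, -35881432069695703613440,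
  -3385546936252133015552, -46883610475896232034304, -14890097220938946838528,
  -3028587968324649877504, -2933437114802657165312, -28821832407616241270784,
  -10472319326785877573632], [-796944718090205436837888, -73022538324560084336640,
  -1247076744711108820992, 32038120246797841727488, 5509535881899047649280,
  -188087942533979909302272, -75283173419828910620672, -1390212239140073635840,
  29961445821497265684480, 0, 0, 0, 0, 0, -70824815836301857914880, -7825043380829036740608,
  -35867449184192766720000, -35881432069695703613440, -3385546936252133015552,
  -11565969980293775622144, 0, -15152001292383267323904], [-1220334919904589846151168,
  101845721577427297107968, 34374382617695826739200, 74677745544733558571008,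
  -1964628440300113625088, -278216651510234677493760, -111244074488145700716544,
  -6816216740292357783552, 26153449339625604382720, 0, 0, 0, 0, 0, 0, 0, 56745534631188322136064,
  -70824815836301857914880, -7825043380829036740608, -26646918432365432406016, 0,
  -14072332126614533439488]], [[], [], [], [], [-874332453450359345512448, 0, 0, 0, 0,
  -119940379496075526930432, 0, 0, -71379906675923421757440, 278743301730634832019456, 0, 0,
  -8620666455606312304640, 324686225124347307098112, 55598556058243024551936, 0,
  98974956250871192616960, 0, 0, 1910658155016745910272, -41828863147210436509696,
  115027941814879811796992], [-351517686125708806455296, -417505614389108853964800, 0, 0, 0,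
  -200518019971569458085888, -41037596390155492524032, 0, -36112225420242230968320,
  188051472048054167666688, -62759584180309822799872, 0, -5161877592147996180480, 0,
  16096807773622465724416, -8620666455606312304640, -31210844158610097045504,
  55598556058243024551936, 0, -2293907807624565358592, -34405180372364294094848,
  33977051778296004608000], [-582213060208169641312256, -14940125648358987530240,
  -264578934961174539665408, 0, 0, -187724658221020914647040, -31085747019266194931712,
  2004424300508265578496, -13402753850638006222848, 370480387187814778798080,
  -78037563216402350866432, -159871159851111625523200, -6658703203691376148480, 0,
  4694860383786144628736, -5161877592147996180480, -17760767294210457993216,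
  16096807773622465724416, -8620666455606312304640, -693589039393512882176,
  -174718918212389437440, 20199849518814199808], [-965847465677847164616704,
  211048410872358650249216, -194421521053143195975680, 92055262837368917327872, 0,
  -225097685472445546364928, -11318253587690083581952, 10437700557370904543232,
  -506342532444423192576, 0, 0, 0, 0, 0, -19227882083732133249024, -6658703203691376148480,
  32582856049571236675584, 4694860383786144628736, -5161877592147996180480,
  -1488463541575638056960, 0, -11135214922398118051840], [-1574632522870119313965056,
  384616024637203575472128, 54684113715911446233088, -35914294104246122971136,
  -368335366029619610255360, -232002062907144155430912, -10494606484765851779072,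
  30282577736820659847168, 5322113916137681977344, 0, 0, 0, 0, 0, 0, 0, 148755755939968582680576,
  -19227882083732133249024, -6658703203691376148480, -12878653368323642753024, 0,
  -23782031605741012910080]], [[], [], [], [], [], [], [626573138058321879629824, 0, 0, 0, 0,
  31759969355357570990080, 0, 0, -115363693696011462508544, 419834222366731825840128, 0, 0,
  -13137714241422455996416, 0, 149069769026826745675776, 0, 195395130514288913940480, 0, 0,
  33689972100227995271168, 7918119637274643660800, 57832886601251580542976],
  [175101355596842729996288, 682410374552857209733120, 0, 0, 0, -117368760021423327543296,
  66128836466414935080960, 0, -89660283203422366203904, 0, 0, 0, 0, 0, 107259295981220581605376,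
  -13137714241422455996416, 75909736655517745414144, 149069769026826745675776, 0,
  29308206321353422274560, 0, 17211296731894242082816], [-630003455289086988779520,
  1040927507580456739536896, 187629374665992098021376, 0, 0, -102559203658561017085952,
  153236413203705164201984, 31200599113029447057408, -51964994340851772555264, 0, 0, 0, 0, 0, 0,
  0, 148519769899654308691968, 107259295981220581605376, -13137714241422455996416,
  27221177305378987180032, 0, -23187067447870870257664]], [[], [], [], [], [], [], [], [],
  [2680636463002394537492480, 0, 0, 0, 0, 2018426899566840745295872, 0, 0,
  -124835843824069296259072, 0, 0, 0, 0, 0, 0, 0, 1500861817176152541757440, 0, 0,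
  -44850823117919272042496, 0, 228878110915978334306304]]], [[], [], [], [], [],
  [[-2126630452217602047475712, 0, 0, 0, 0, -38472507945612275236864, 0, 0,
  -52316428677979843067904, -38472507945612275236864, 0, 0, -8137358735494186532864,
  -52316428677979843067904, 0, 0, 0, 0, 0, 0, 0, 0], [-982170872742419641139200,
  394193980374940841918464, 0, 0, 0, -17225117888380983255040, 22977100230015894765568, 0,
  -37020809524557684408320, -17225117888380983255040, 22977100230015894765568, 0,
  -4565626532542037966848, -37020809524557684408320, 11894744675725100515328,
  -8137358735494186532864, 0, 0, 0, 0, 0, 0], [-314790526428525961936896,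
  24472423849611615436800, -113594641691648231718912, 0, 0, 19208952388827494105088,
  20886293570476302778368, 2484468772547576332288, -24149563467112101707776,
  19208952388827494105088, 20886293570476302778368, 2484468772547576332288,
  -1293953681871440412672, -24149563467112101707776, 16541365011212074164224,
  -4565626532542037966848, 2689659212423988658176, 11894744675725100515328,
  -8137358735494186532864, -1796772589600489734144, -1796772589600489734144, 0],
  [27137199502353674862592, 132252877417082537633792, -13947184528077163517952,
  41129906803357764648960, 0, 48191704045938513213440, 19197721044147786825728,
  1137123736570742341632, -15322089299472025976832, 48191704045938513213440,
  19197721044147786825728, 1137123736570742341632, 2106486496605280190464,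
  -15322089299472025976832, 24504857793760300113920, -1293953681871440412672,
  96137016503411456985088, 16541365011212074164224, -4565626532542037966848,
  1552183347110079922176, 1552183347110079922176, 0], [162814618564211610484736,
  229808833562289491353600, 50668149925274621583360, 56985153420055944187904,
  38631965622464492339200, 67094397474647437500416, 16939141426732888072192,
  -2550303391163448229888, -12157781652538383269888, 67094397474647437500416,
  16939141426732888072192, -2550303391163448229888, 6064521835330155315200,
  -12157781652538383269888, 35896746217704954331136, 2106486496605280190464,
  105553704924659441360896, 24504857793760300113920, -1293953681871440412672,
  3866151087365468258304, 3866151087365468258304, -6703615748590791032832],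
  [228688980831370727129088, 279975654471027317489664, 106638239239275583279104,
  75996412066993262153728, 57868639976601796870144, 74737634983201397968896,
  12452954777701256798208, -7223877880883348111360, -16276033446337261993984,
  74737634983201397968896, 12452954777701256798208, -7223877880883348111360,
  11008981322574662025216, -16276033446337261993984, 50532662624900309123072,
  6064521835330155315200, 85298759365940428124160, 35896746217704954331136,
  2106486496605280190464, 4703736204288861536256, 4703736204288861536256,
  -12008706698381066895360], [392359858969376055623680, 364969478378024075362304,
  182641414209669090877440, 115575472687635604303872, 79407176681344025755648,
  76971446925578975191040, 6187290497926476259328, -11529663897559030628352,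
  -29296238342073080217600, 76971446925578975191040, 6187290497926476259328,
  -11529663897559030628352, 17368695105914811154432, -29296238342073080217600,
  69855735863665637777408, 11008981322574662025216, 98930435065591917322240,
  50532662624900309123072, 6064521835330155315200, 3623545439850591879168,
  3623545439850591879168, 4375613054291100303360], [848605609369025744666624,
  556736708763872004536320, 311853728507760465143808, 181565101932634774654976,
  107927133610996794130432, 92652777448092045989888, 12695548432628113408,
  -14113724488109936115712, 0, 92652777448092045989888, 12695548432628113408,
  -14113724488109936115712, 25572494495706235486208, 0, 97075407370625403183104,
  17368695105914811154432, 173204437487473463044096, 69855735863665637777408,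
  11008981322574662025216, 184186038759205994496, 184186038759205994496,
  43029677936002593718272], [1815409833280402030067712, 998020132353996719112192,
  535493702346606302281728, 281867206447183368724480, 148108069694585124683776,
  167934571129068380405760, -2079074608450315272192, -13622121568612518330368, 0,
  167934571129068380405760, -2079074608450315272192, -13622121568612518330368,
  36049211968559277932544, 0, 137937718774236766208000, 25572494495706235486208,
  388057553715982495039488, 97075407370625403183104, 17368695105914811154432,
  -6055734917647466102784, -6055734917647466102784, 104533758751079116308480],
  [3547868762843762842402816, 2203327711872846165524480, 907460658754143874867200,
  440236774661703819239424, 204629544962944140574720, 0, 0, 0, 0, 0, 0, 0, 0, 0,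
  204543744435781443977216, 36049211968559277932544, 846801523835273881624576,
  137937718774236766208000, 25572494495706235486208, 0, 0, 189468190362127438184448],
  [6387860496914154691493888, 5588990099506480874881024, 1500801296678947225288704,
  720002833630399212904448, 282171120595809758347264, 0, 0, 0, 0, 0, 0, 0, 0, 0, 0, 0,
  2293852636894248353873920, 204543744435781443977216, 36049211968559277932544, 0, 0,
  298413499370567643955200]], [[], [], [-380031534438762368991232, 0, 0, 0, 0,
  -28447861715643240792064, 0, 0, -52504025730494494146560, 72888817288431308767232, 0, 0,
  -6881550385168713711616, -50967086082623727599616, 41980004916014085931008, 0,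
  647884561868434411601920, 0, 0, -4950614423119690727424, -19519620195472957308928, 0],
  [-155420287711539636338688, -71348274018174838988800, 0, 0, 0, 6233104621039015643136,
  19915218224596218867712, 0, -26096804512931058614272, 22994128594150554140672,
  29409597510531590914048, 0, -1681859891123837091840, -34991138424437408595968,
  21790990561484624625664, -6881550385168713711616, 110660044440899795034112,
  41980004916014085931008, 0, 1997420012969248833536, -12420416225735113441280, 0],
  [-38235708582514698223616, 29506430070761318416384, -120184301211860443955200, 0, 0,
  24431284681343200911360, 11805359296051437535232, -4209040533289692069888,
  -7930247108215257563136, -7756646436294130663424, 14267779930070008725504,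
  -5169760467206788087808, 1482542888154397376512, -25217549776173050626048,
  12768964033595393269760, -1681859891123837091840, 48038082611909791956992,
  21790990561484624625664, -6881550385168713711616, 5462662546591803867136,
  -6092629929518536261632, 7031752384119332405248], [-48623574519975883374592,
  66608265691406774292480, -23495427837746274144256, 43918369810047749718016, 0,
  18782666644088549961728, -2428419880060613419008, -1758149543339211685888,
  3319407220775500447744, -22397319404360670478336, 2091023171790214135808,
  -3259726869616637345792, 3730955929250807939072, -24137218114128311255040,
  13009576199256777621504, 1482542888154397376512, 8268272132658952960000,
  12768964033595393269760, -1681859891123837091840, 5851677609442702934016,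
  -1885249248657945247744, -12765868945757070622720], [-102504173677120472481792,
  67995684431387911528448, 35316704953283696500736, 53548748869594276691968,
  65189946017711080669184, -3613395555452409077760, -19785420117392722952192,
  -4958234203346231853056, 8975920230981193170944, -14999669735414267183104,
  -5361692666978089828352, -4609894804714354442240, 6182678312001393426432,
  -34241040382137868156928, 18764583513860572659712, 3730955929250807939072,
  -10855507670172170461184, 13009576199256777621504, 1482542888154397376512,
  3571030692219015397376, -1147262821257681207296, -15991358579142774620160],
  [-96872117240810887380992, 87175245254338053050368, 93339886317053884461056,
  78858130475416683151360, 70215619952471844028416, -28820715737547025127424,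
  -39563487713813892812800, -9922338475098012205056, 10363054702310923960320,
  -7709076334769719574528, -13663711965112458412032, -7183359926860743016448,
  9957010215413881913344, 0, 31125821972857659588608, 6182678312001393426432,
  2471883385823355023360, 18764583513860572659712, 3730955929250807939072,
  -972711654523667431424, -5227659199737743474688, -3085559693285764038656],
  [107263623038176546783232, 213933436284514422128640, 183724244213023031066624,
  134412671270260971667456, 79795960487670935977984, -36053860385026029666304,
  -56408799953127358660608, -12763505252815600156672, 8804574440794661060608,
  21090566575889974034432, -22937602973133341458432, -8943215509577078669312,
  16173252913588279377920, 0, 51453490566897326874624, 9957010215413881913344,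
  98037281273783689633792, 31125821972857659588608, 6182678312001393426432,
  -7372981819515051147264, -15475426068879827107840, 25510685158664012300288],
  [701939677314902839394304, 587920758123818473693184, 338510713820057467904000,
  233598710224935977746432, 101069013994954166042624, 4348001907656862474240,
  -65290328405798726156288, -9594776378170941636608, 0, 0, 0, 0, 0, 0, 85950476268252263219200,
  16173252913588279377920, 301687655560395529664512, 51453490566897326874624,
  9957010215413881913344, -15223211129913957105664, 0, 69356533883540846542848],
  [1846938465301510145179648, 1339297998074260290519040, 612629363343327878365184,
  374605179460046567243776, 141172829142084596662272, 151836625884346537033728,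
  -37392900092146524356608, 3470807344696008179712, 0, 0, 0, 0, 0, 0, 0, 0,
  649315035005507880796160, 85950476268252263219200, 16173252913588279377920,
  -24116829850452141277184, 0, 128011144684049477140480]], [[], [], [], [],
  [-261363679433175932600320, 0, 0, 0, 0, 22266694501305456885760, 0, 0,
  -50064597738040497864704, 118669595870667393204224, 0, 0, 6704959708810996613120,
  -27279894800575275991040, 68059695776953180618752, 0, 192768434505985350189056, 0, 0,
  11164914810148700028928, -4628816710590904795136, 37976498652760764448768],
  [-46915215364461565050880, 40473270787070042308608, 0, 0, 0, -4940659301430411751424,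
  33825752527537222451200, 0, -13289533794719997886464, -8263142836094224039936,
  31245306009637696307200, 0, 5269409352145009999872, -19622004398793829646336,
  24807884139834421805056, 6704959708810996613120, 61584048486318264885248,
  68059695776953180618752, 0, 14179925782895403335680, -7847505585020494872576,
  639933067014919421952], [-184909766766091520966656, -36085353288482392375296,
  -96221598870871390289920, 0, 0, -54175622455551599157248, -7452108951706317619200,
  -4684846833516052807680, 10478050955052003688448, -82521237524231915307008,
  -9665762303021898792960, -16815418650057989160960, 463397890756125982720,
  -47611735682941139812352, -3581402078060052348928, 5269409352145009999872,
  -33868524941542427754496, 24807884139834421805056, 6704959708810996613120,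
  10495452522141925507072, -11957941931925710307328, -18338675175184740253696],
  [-505334088818261292482560, -135311413528880315498496, -89894194094997713453056,
  8872481102577319018496, 0, -134903626278527499333632, -46641377827425750876160,
  -4211368428840771223552, 25376206349593944752128, -142300828496379189133312,
  -47518787836202800906240, -25338037827432962064384, -5486103264507334131712, 0,
  -21994964296707339583488, 463397890756125982720, -91486109073728054603776,
  -3581402078060052348928, 5269409352145009999872, 1303339432374917791744,
  -19694080476391966343168, -20395275465649053138944], [-808569899410726190055424,
  -233244404944446912724992, -94466724194165953921024, 19465581697371675295744,
  26898879937116974874624, -238146924670005373730816, -86585519715765434974208,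
  -11271993984961617330176, 35542983464334536343552, -145251549675492210638848,
  -82893373864290119843840, -33552182911578918617088, -10352121718996398243840, 0,
  -32329772811959308648448, -5486103264507334131712, -70093745821481248694272,
  -21994964296707339583488, 463397890756125982720, -12204567788363544264704,
  -33789875516874601070592, -6965813212649301934080], [-865393879142801342464000,
  -240307844210057157279744, -104450312754932239826944, 41824045389657126469632,
  -3312287274590147706880, -362946473398666103644160, -120316152924204012404736,
  -18043561915442066817024, 45116434655566319845376, 0, 0, 0, 0, 0, -33558464429338898464768,
  -10352121718996398243840, 48703746350278080352256, -32329772811959308648448,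
  -5486103264507334131712, -28836422136590151974912, 0, 20513767880797166501888],
  [-416977671323361696808960, -8266180318682988675072, -58901577980444195946496,
  103713951080386868019200, -29495140593027340304384, -513932695798898637062144,
  -149484244032264562278400, -16702909685053532274688, 58234613604199224180736, 0, 0, 0, 0, 0, 0,
  0, 305723493868652106579968, -33558464429338898464768, -10352121718996398243840,
  -47400375291494554664960, 0, 60607523538641321132032]], [[], [], [], [], [], [],
  [-72694706031323976302592, 0, 0, 0, 0, 269192089526376268300288, 0, 0,
  -35289138326933050425344, 280882433901448853979136, 0, 0, -16386653008411976794112,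
  272482297317295564783616, 105307959713423711797248, 0, 346399139011734588620800, 0, 0,
  25888834807978951180288, -52236416955695146991616, -2809453558785065484288],
  [-41926300045221778423808, 472819611485243229339648, 0, 0, 0, 34185633421292555468800,
  47585078395983298035712, 0, -9120139017702441254912, -46055040380113057218560,
  -31154512504237942898688, 0, -17732421020101969444864, 0, 45630269007478776659968,
  -16386653008411976794112, 92499701495353150799872, 105307959713423711797248, 0,
  20833200488433654464512, -55954076847795834191872, -15503903607692626034688],
  [-599942940719051022794752, 269773136888520679358464, -310920537852494477262848, 0, 0,
  -127558159981250487517184, -15199225489043799146496, -17408235744913419927552,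
  -1382069193877339504640, -97494913054812548366336, -168174509707460610097152,
  -115716660248189025124352, -31843523371604341948416, 0, 5378007491645799661568,
  -17732421020101969444864, 79376574433689931350016, 45630269007478776659968,
  -16386653008411976794112, 6901978609848620351488, -20486679896187006353408,
  -7047584479628023824384], [-1008777123986085569888256, 128467393417009914970112,
  -394923525490510382759936, 10464053843487744851968, 0, -314881481871384818745344,
  -69355408135694376239104, -4480601321108917977088, 7003291356507455291392, 0, 0, 0, 0, 0,
  -22849113156213855485952, -31843523371604341948416, 129506490907628701745152,
  5378007491645799661568, -17732421020101969444864, -10528508686428918480896, 0,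
  15852354320601449988096], [-1056892746925506415296512, 195290008403989298675712,
  -439248676301124159930368, -40678811782164602945536, -349982984169617037983744,
  -423290827318490468188160, -117432686042583790518272, 4243028469984343883776,
  35114116502960176758784, 0, 0, 0, 0, 0, 0, 0, 361089772294686323507200,
  -22849113156213855485952, -31843523371604341948416, -26081987311455513608192, 0,
  46488742450023051362304]], [[], [], [], [], [], [], [], [], [501437085765371179302912, 0, 0, 0,
  0, 198643549094900295270400, 0, 0, -114428450629983846531072, 569475477001389723353088, 0, 0,
  -10493686756126413029376, 0, 175075796267240064548864, 0, 334957697294304815349760, 0, 0,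
  32690270870817338294272, 19531579814336952008704, 4930835976456117420032],
  [209779031348308661501952, 1136644287152867682287616, 0, 0, 0, -70375836986654291132416,
  114017386278751628689408, 0, -102713590652676369022976, 0, 0, 0, 0, 0,
  114324245038282389323776, -10493686756126413029376, 180291317579229775790080,
  175075796267240064548864, 0, 13345495722411639701504, 0, -5605685010735539683328],
  [-912523660628367085928448, 1411618783163113757736960, 223680187503559481229312, 0, 0,
  -186402280866128601284608, 66388334394373228724224, 11354614707792402972672,
  -100062865940710728663040, 0, 0, 0, 0, 0, 0, 0, 303333989534115165110272,
  114324245038282389323776, -10493686756126413029376, -13497724948004380606464, 0,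
  -18210882399486804492288]], [[], [], [], [], [], [], [], [], [], [],
  [1513040518315816177893376, 0, 0, 0, 0, 1413418791187757788037120, 0, 0,
  -185737342761407881412608, 0, 0, 0, 0, 0, 0, 0, 1425116075653872933142528, 0, 0,
  -83959391585941304901632, 0, 128225123797946500907008]]], [[], [], [], [], [], [], [[], [], [],
  [], [131757837789320832876544, 0, 0, 0, 0, 27895324953040836526080, 0, 0,
  -13094793348404173471744, 27895324953040836526080, 0, 0, 7761250016286457315328,
  -13094793348404173471744, 43804326928498853965824, 0, 38183367541487862300672, 0, 0,
  8576547001935301771264, 8576547001935301771264, -22618619326796008521728],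
  [59838405272481051738112, 38883885471235215831040, 0, 0, 0, 23271898773736567828480,
  29776093345662057283584, 0, -1532909549477536841728, 23271898773736567828480,
  29776093345662057283584, 0, 9663636424308097122304, -1532909549477536841728,
  27493163355342909390848, 7761250016286457315328, 18060749775189605451776,
  43804326928498853965824, 0, 11074225437872711057408, 11074225437872711057408,
  -35490120652677500600320], [-2813831720346630619136, 77473491595256610217984,
  -66460114775680781987840, 0, 0, 6767442832330104348672, 9613374894791112065024,
  1654306311091570606080, 2127619301767252901888, 6767442832330104348672, 9613374894791112065024,
  1654306311091570606080, 9812326623944950431744, 2127619301767252901888,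
  19507743187459092078592, 9663636424308097122304, -13430697392723326640128,
  27493163355342909390848, 7761250016286457315328, 9922209254814774558720,
  9922209254814774558720, -36265790131713081016320], [-10370084452977804738560,
  79831445759532761018368, 16762041139704060229632, 67685268616311594745856, 0,
  -16439668790502811275264, -10526719043586690154496, 3757970422746995884032,
  -111949824502073245696, -16439668790502811275264, -10526719043586690154496,
  3757970422746995884032, 11436707859486298234880, -111949824502073245696,
  22895099413593530941440, 9812326623944950431744, -27228791008589986222080,
  19507743187459092078592, 9663636424308097122304, 6216692914083489120256,
  6216692914083489120256, -24556175314516796014592], [52516528601895943536640,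
  77882450583529321234432, 70694912528561322934272, 72519492550750626119680,
  86611681581142956376064, -17734534744606738055168, -25326067434492563030016,
  2129330073930726113280, -6250357779750134087680, -17734534744606738055168,
  -25326067434492563030016, 2129330073930726113280, 17766168414984957558784,
  -6250357779750134087680, 40414128594220690829312, 11436707859486298234880,
  12179732321058550784000, 22895099413593530941440, 9812326623944950431744,
  1053871883701659533312, 1053871883701659533312, 28177218384592240640],
  [317201215927482961690624, 179533511046551260880896, 136325124242736300175360,
  120292742693169822302208, 101595317729981862363136, 8828214042575561318400,
  -26654515123075291611136, 2701527661853127475200, 0, 8828214042575561318400,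
  -26654515123075291611136, 2701527661853127475200, 32030097619046202605568, 0,
  82806586510286547288064, 17766168414984957558784, 120071352926401801152512,
  40414128594220690829312, 11436707859486298234880, -4470057362612183678976,
  -4470057362612183678976, 37876721856762548846592], [884557278798115601907712,
  449455873329028973608960, 264700456760201852706816, 224044602082191401025536,
  128107884947076662919168, 93803460766361759170560, -13120406527880757641216,
  11407707841070608416768, 0, 93803460766361759170560, -13120406527880757641216,
  11407707841070608416768, 57457885849616685891584, 0, 149161307833552326770688,
  32030097619046202605568, 339950678421531599486976, 82806586510286547288064,
  17766168414984957558784, -9258897346448866476032, -9258897346448866476032,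
  89378913960897709342720], [1971466345444026149699584, 1019134957675489677205504,
  502791597959619990220800, 412106989633839377022976, 177059269466360448204800, 0, 0, 0, 0, 0, 0,
  0, 0, 0, 351634516730132219789312, 57457885849616685891584, 737950384770552932114432,
  149161307833552326770688, 32030097619046202605568, 0, 0, 154924209861790822891520],
  [4936250010204778324295680, 3050179807154185559769088, 1276577263103470672986112,
  997038138885414682361856, 259359362411246762524672, 0, 0, 0, 0, 0, 0, 0, 0, 0, 0, 0,
  1730819417466783879741440, 351634516730132219789312, 57457885849616685891584, 0, 0,
  234902066861373695459328]], [[], [], [], [], [], [], [133078054560378149404672, 0, 0, 0, 0,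
  21436425390524981534720, 0, 0, 9904137126374486376448, 90273476305040665739264, 0, 0,
  26321414059484925657088, 15940075285056279543808, 63545069870720888995840, 0,
  39221357229998685552640, 0, 0, 21168633601337890635776, 26887636255650122694656,
  -46220806705566112415744], [146063044254291273449472, 134304901825931640176640, 0, 0, 0,
  -20296503551352508379136, 39503917976572157755392, 0, 17281047201835247566848,
  2410009951883280515072, 30177876800602031783936, 0, 21275673064492216221696,
  -11645319048189641228288, 30132960111475289751552, 26321414059484925657088,
  -27153519089700612014080, 63545069870720888995840, 0, 16272975557275110211584,
  18524914758902669688832, -45755856672813759692800], [162320633430053513854976,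
  166374546961891069001728, -82239674225403357036544, 0, 0, -64287195694701309493248,
  -14977290396578843983872, 16159068984200197242880, 18112763961792186810368,
  -31950199992364470108160, -18669665168714620731392, -1120231287991845257216,
  16739221176402276515840, -63997252958335243649024, 22832937736914921979904,
  21275673064492216221696, -37332462574123389943808, 30132960111475289751552,
  26321414059484925657088, 7464577698579762184192, 9612138222858590257152,
  -31800940000314818494464], [284633388616361552379904, 154356008282412159598592,
  -44294894796021245673472, 51112116876186208436224, 0, -118893626756586922663936,
  -49063383890232249679872, 18501346255877341528064, 18715565864293350965248,
  -33441698562321732861952, -39878501460644273848320, -2842148299989720236032,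
  19215454676962896510976, 0, 44522899163022657323008, 16739221176402276515840,
  15932464940031140233216, 22832937736914921979904, 21275673064492216221696,
  -1818567173412351016960, 2339198850153823649792, -3188874257261961347072],
  [654981958500231388594176, 158497533040414348541952, -12413223661764819812352,
  45240610713726836801536, 25622123741966036369408, -149088298301235968655360,
  -50006127479263778045952, 17928528946985629286400, 25405734048344204771328,
  35431061495013133254656, -20149106836189613129728, 716451581530013171712,
  35207770780693050163200, 0, 102886408363667133038592, 19215454676962896510976,
  183112915135123317850112, 44522899163022657323008, 16739221176402276515840,
  -8138465012660615380992, -1104010256439631020032, 41247524178647364730880],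
  [1454545073926998339878912, 272278057709184765657088, 21702403232652707495936,
  105546008152129820950528, -2921194802817947140096, -169160693010357157355520,
  -15593498405579162910720, 26401809926119288225792, 0, 0, 0, 0, 0, 0, 207581229029469205299200,
  35207770780693050163200, 481046145245975937679360, 102886408363667133038592,
  19215454676962896510976, -8057120542372511350784, 0, 102675440124139325915136],
  [2903699547900317041426432, 622281093619331382640640, 100183193945787368210432,
  274315838291352742789120, -14437728804552551956480, 135769850449780432338944,
  68078823702115387441152, 55882384082283412127744, 0, 0, 0, 0, 0, 0, 0, 0,
  940716419843063342694400, 207581229029469205299200, 35207770780693050163200,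
  1863462731043480141824, 0, 182262059593292089262080]], [[], [], [], [], [], [], [], [],
  [229567292869955456860160, 0, 0, 0, 0, 70606587260904949153792, 0, 0, -10207539342512367796224,
  196515471477084264595456, 0, 0, 20046934245789885530112, -222281835991595223089152,
  80833474742927394078720, 0, 6056391651294734974976, 0, 0, 8211109156593150459904,
  -5634390202486515302400, -76109825900294906183680], [398099066962877853204480,
  551342650032033812709376, 0, 0, 0, -65565719119935415255040, 73092667083710100668416, 0,
  -7750519896251615821824, 44315785619738711818240, -47584373046708562558976, 0,
  12857664053865879699456, 0, 49292289321351029719040, 20046934245789885530112,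
  -58275803687744788234240, 80833474742927394078720, 0, 1890593790125530021888,
  -16518042459903669305344, -49418139091803873722368], [466076923078950346817536,
  624326424384000743178240, -176517076079109575016448, 0, 0, -155409332123260723134464,
  -728485337833314189312, 73781904115599419637760, -17190097664315027914752,
  173808163293836225806336, -143158165909472762920960, -261577779641330262081536,
  -5803018318834544148480, 0, 66795477346053101977600, 12857664053865879699456,
  100891112477386650681344, 49292289321351029719040, 20046934245789885530112,
  -13316792008202928521216, 5544592821699878060032, -13727056143701734752256],
  [992397991243494673350656, 709269015762673401331712, -215102405306234183876608,
  -65708863488839481556992, 0, -252038757665548548177920, 21180926738432353894400,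
  62372773144415227084800, -9314924224716040126464, 0, 0, 0, 0, 0, 170965347041113087672320,
  -5803018318834544148480, 378317240054051234643968, 66795477346053101977600,
  12857664053865879699456, -21543461022761971613696, 0, 36269257785501186277376],
  [1838946217191747530784768, 948196735784556861325312, -152310391201340059549696,
  6194441859711063031808, -912945835236079494496256, -290093161749899748835328,
  171271549816173443940352, 63877653136792019271680, 45086250160313042141184, 0, 0, 0, 0, 0, 0,
  0, 882889569479570103468032, 170965347041113087672320, -5803018318834544148480,
  -6921871597860277452800, 0, 105876593571373852786688]], [[], [], [], [], [], [], [], [], [],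
  [], [408841288070209464172544, 0, 0, 0, 0, -53212161607163642380288, 0, 0,
  -70113740496222189256704, 109144609820974700822528, 0, 0, -22148215820148528906240, 0,
  1589374449861691179008, 0, -138061444490772267139072, 0, 0, -9252261785775848292352,
  -6071767668630522691584, -59203479673758975787008], [112312338210217342795776,
  703232570126010347945984, 0, 0, 0, -271759273606360554536960, 65551395999741464543232, 0,
  -83526089879650115256320, 0, 0, 0, 0, 0, 33889155108956322922496, -22148215820148528906240,
  -174607275218326473670656, 1589374449861691179008, 0, -27239758897075372163072, 0,
  -46347154433943348969472], [-933833561397133605601280, 823682116840656923000832,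
  -127853701624112886054912, 0, 0, -317194542271222182313984, 40616850693093154881536,
  -25571029972463204171776, -85574839752051996491776, 0, 0, 0, 0, 0, 0, 0,
  76032219127663174877184, 33889155108956322922496, -22148215820148528906240,
  -41777545171581787963392, 0, -26504196765802431512576]], [[], [], [], [], [], [], [], [], [],
  [], [], [], [-3591666795059094371696640, 0, 0, 0, 0, 110874576534491990327296, 0, 0,
  -486441579937201928536064, 0, 0, 0, 0, 0, 0, 0, 33324132255505397579776, 0, 0,
  -181224982317149242523648, 0, -139442023667718409945088]]], [[], [], [], [], [], [], [], [[],
  [], [], [], [], [], [], [], [577841114039067919515648, 0, 0, 0, 0, 206363639425290133831680, 0,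
  0, 30393921622429619191808, 206363639425290133831680, 0, 0, 50403052980073151397888,
  30393921622429619191808, 94398104015300323442688, 0, 111351020122600141099008, 0, 0,
  24844503540840797503488, 24844503540840797503488, -81720165362796911067136],
  [1081547812678531786211328, 796872016825667095887872, 0, 0, 0, 106030168929259194679296,
  10476691263903060983808, 0, -6830634802988479152128, 106030168929259194679296,
  10476691263903060983808, 0, 57804606020661568847872, -6830634802988479152128,
  94950554606415793881088, 50403052980073151397888, 85957423465578336720896,
  94398104015300323442688, 0, 16347102440922004881408, 16347102440922004881408,
  -60972773838649718734848], [1713426136401770459430912, 1005955681687033283608576,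
  106736244199555081437184, 0, 0, 160495803845521658871808, -18189707323208705769472,
  -14405142604377713803264, -58613067137370034274304, 160495803845521658871808,
  -18189707323208705769472, -14405142604377713803264, 72593169107774337155072,
  -58613067137370034274304, 165284374545646097924096, 57804606020661568847872,
  201204181066405519179776, 94950554606415793881088, 50403052980073151397888,
  12228969312042137419776, 12228969312042137419776, -18887770568080268263424],
  [2714241146847039313674240, 1275898583313795762487296, 138439936830420486455296,
  110823983731338673913856, 0, 347217500539574611869696, 57912374397412101849088,
  14119605457806350614528, 0, 347217500539574611869696, 57912374397412101849088,
  14119605457806350614528, 107883346511471907225600, 0, 312310495814289063542784,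
  72593169107774337155072, 494884003575224483770368, 165284374545646097924096,
  57804606020661568847872, 19413433235673870827520, 19413433235673870827520,
  48194944676314941784064], [4357005788480183029727232, 1666956707284978436145152,
  386830637253919442468864, 206901226243269947555840, 189115191267490841755648,
  683987669641904542187520, 252719012657434321747968, 50170302663858082283520, 0,
  683987669641904542187520, 252719012657434321747968, 50170302663858082283520,
  176789743336680541585408, 0, 546430024578927770730496, 107883346511471907225600,
  1002313316472346186145792, 312310495814289063542784, 72593169107774337155072,
  44823824401104003268608, 44823824401104003268608, 143935473571612222685184],
  [6946980888594635594661888, 2295094157184014525661184, 843921573117047755767808,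
  508915616170727056605184, 396533274119236629823488, 0, 0, 0, 0, 0, 0, 0, 0, 0,
  905541423854335313051648, 176789743336680541585408, 1777609378020006356922368,
  546430024578927770730496, 107883346511471907225600, 0, 0, 271993919285213606969344],
  [10821675157311420301836288, 3333317127755952359473152, 1995986657920984781160448,
  1104609413398749027237888, 694502365705754585858048, 0, 0, 0, 0, 0, 0, 0, 0, 0, 0, 0,
  3601100265347250759254016, 905541423854335313051648, 176789743336680541585408, 0, 0,
  436030386515499759828992]], [[], [], [], [], [], [], [], [], [], [],
  [1959786393703910039617536, 0, 0, 0, 0, 426770489155685660491776, 0, 0,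
  52538433930139845787648, 788366735907587534880768, 0, 0, 60455504461644357959680,
  -339358846985903640936448, 257033146764222277353472, 0, 262784410553937339351040, 0, 0,
  -40175491586973666443264, 21125225179743225118720, -116884923875109042061312],
  [2978328775152190416224256, 2942251282241505600733184, 0, 0, 0, 220843268733270740434944,
  124872082512360925298688, 0, 11698699557999682256896, 895582071464958936219648,
  -6396927483891127681024, 0, 72502615706386925879296, 0, 354109823281537469120512,
  60455504461644357959680, 402594283009819216445440, 257033146764222277353472, 0,
  -38965168032755485294592, 6555779504671939362816, -53907740469751844601856],
  [4143218389410431568445440, 3687569565757883054817280, 276181680024522963550208, 0, 0,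
  586152952542241496236032, 117354293973838515404800, 136817278737601422950400,
  -47448277753894541459456, 1621157111112373565915136, 102483026205787962736640,
  -982099493762322206294016, 81506276632252584558592, 0, 626164501399119738437632,
  72502615706386925879296, 985775772757456788127744, 354109823281537469120512,
  60455504461644357959680, -38620062754375184777216, 42833674007885027213312,
  21005319766616125472768], [6181833855378444961972224, 4780843348899177380708352,
  619239660785116481847296, 169387438035652801724416, 0, 1370265606496974880112640,
  441775657846832834281472, 159267761881795868491776, 0, 0, 0, 0, 0, 0,
  1125001575410298117947392, 81506276632252584558592, 1959448946441061114314752,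
  626164501399119738437632, 72502615706386925879296, -7104021733888314687488, 0,
  124746107671208972976128], [9248127791023466829840384, 6358216069642704146923520,
  1703638708651093510848512, 835865947020258168537088, 1583309014086287269822464,
  4222535501363333009768448, 1135911016227754406313984, 161122968343687873953792, 0, 0, 0, 0, 0,
  0, 0, 0, 3411529108274856280981504, 1125001575410298117947392, 81506276632252584558592,
  87619068268765302292480, 0, 274206419971567783903232]], [[], [], [], [], [], [], [], [], [],
  [], [], [], [311936775525522284216320, 0, 0, 0, 0, 190348907064231739785216, 0, 0,
  62137574685327717564416, 633434584573407561515008, 0, 0, -57316193154397988978688, 0,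
  151245330163521837596672, 0, -315906033112074682368, 0, 0, -86425576901632176685056,
  -9236003657267130925056, -90095270168340576862208], [38754294642220885606400,
  2028141831084199915814912, 0, 0, 0, 46931817169897717235712, 77258882530651316158464, 0,
  75757810058413628981248, 0, 0, 0, 0, 0, 486254011000942518861824, -57316193154397988978688,
  123106044912584846475264, 151245330163521837596672, 0, -59893141258591067439104, 0,
  -35237595283256737005568], [-841383027862415823863808, 2119926081539313189781504,
  520258380410154370727936, 0, 0, 828652281560284287467520, 204655458100416411074560,
  71939391010460839968768, 139770799531637751152640, 0, 0, 0, 0, 0, 0, 0,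
  880510797740656419667968, 486254011000942518861824, -57316193154397988978688,
  -15563621734446574600192, 0, 52392335186959030812672]], [[], [], [], [], [], [], [], [], [],
  [], [], [], [], [], [-9410007541273997430751232, 0, 0, 0, 0, 2596593752601294008221696, 0, 0,
  770595546524281926057984, 0, 0, 0, 0, 0, 0, 0, 1370013470992122802864128, 0, 0,
  -528228626974501563793408, 0, -188429337092655708897280]]], [[], [], [], [], [], [], [], [],
  [[], [], [], [], [], [], [], [], [], [], [], [], [6406354116741297027940352, 0, 0, 0, 0,
  3618182064021029838127104, 0, 0, 854152778691219950665728, 3618182064021029838127104, 0, 0,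
  213707265569958186188800, 854152778691219950665728, 1129473936037010271371264, 0,
  3067284301865644230443008, 0, 0, -35500662192679354892288, -35500662192679354892288,
  -70992847337233618763776], [8118038837133633870888960, 20304717386698361743081472, 0, 0, 0,
  4510186671617753808371712, -357469538733316668129280, 0, 0, 4510186671617753808371712,
  -357469538733316668129280, 0, 358913543155021359611904, 0, 2352978872465789755064320,
  213707265569958186188800, 4506364451054757589811200, 1129473936037010271371264, 0,
  -21811259631163085422592, -21811259631163085422592, 49598741905767355498496],
  [10166466544278394988658688, 22733382548089612642811904, 11341828972219110856327168, 0, 0,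
  7415845347940502970826752, 394633788183735554801664, -536570399496731673755648, 0,
  7415845347940502970826752, 394633788183735554801664, -536570399496731673755648,
  700772593005181678911488, 0, 4136902678279463238107136, 358913543155021359611904,
  7529568150788432160882688, 2352978872465789755064320, 213707265569958186188800,
  28654454205617834819584, 28654454205617834819584, 166154570184117701279744],
  [13316860102912564778762240, 27923598872934527814074368, 14978665845808090996277248,
  1737411030376902297649152, 0, 0, 0, 0, 0, 0, 0, 0, 0, 0, 6834585842500740020436992,
  700772593005181678911488, 11604017558314626364997632, 4136902678279463238107136,
  358913543155021359611904, 0, 0, 357012458732760039342080], [28530999475909500013117440,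
  36117662385625451152277504, 22621971695489025524629504, 6806149732968565481406464,
  32626620476046551900225536, 0, 0, 0, 0, 0, 0, 0, 0, 0, 0, 0, 22767411042335442869420032,
  6834585842500740020436992, 700772593005181678911488, 0, 0, 700512220526893483360256]], [[], [],
  [], [], [], [], [], [], [], [], [], [], [], [], [178670608737307465875456, 0, 0, 0, 0,
  1077438873214520846712832, 0, 0, 1675178358902022824001536, 7054447394159879119699968, 0, 0,
  -43489895052105656303616, 0, 2125350265204625356357632, 0, 4030771801864027731132416, 0, 0,
  -5066804230762430201856, 42033572583981239500800, 44990112653020458123264],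
  [-198579549789736497315840, 20138629053941297983782912, 0, 0, 0, 1782879152720205114769408,
  -1186654284365595955691520, 0, 0, 0, 0, 0, 0, 0, 4272456675470680910725120,
  -43489895052105656303616, 4837737762037750902554624, 2125350265204625356357632, 0,
  64921383803675668905984, 0, 160760747633741219758080], [-1272275392964738584412160,
  20790095489195431967064064, 6535513643693584263675904, 0, 0, 6671266297390400656113664,
  -867293192881829226479616, 1439043330818616823119872, 0, 0, 0, 0, 0, 0, 0, 0,
  8009487115415293943349248, 4272456675470680910725120, -43489895052105656303616,
  216826017586867353944064, 0, 299642473596618975215616]], [[], [], [], [], [], [], [], [], [],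
  [], [], [], [], [], [], [], [-6972592257663617275527168, 0, 0, 0, 0,
  17212200917476006684524544, 0, 0, 16350182518793057767260160, 0, 0, 0, 0, 0, 0, 0,
  17492332944356738940796928, 0, 0, -255835098931050921852928, 0, 389709504109821107896320]]],
  [[], [], [], [], [], [], [], [], [], [[], [], [], [], [], [], [], [], [], [], [], [], [], [],
  [], [], [-878956363700757071921152, 0, 0, 0, 0, 8664972053912259043262464, 0, 0, 0,
  8664972053912259043262464, 0, 0, 119994374146096925507584, 0, 4743201521266468161847296, 0,
  10244153827497279391531008, 0, 0, 31980031615641883508736, 31980031615641883508736,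
  445268648381604555653120], [4150955012850402969255936, 35380688743868298214506496, 0, 0, 0, 0,
  0, 0, 0, 0, 0, 0, 0, 0, 8704564000401940079968256, 119994374146096925507584,
  10791829473774921857368064, 4743201521266468161847296, 0, 0, 0, 636702351589069276839936],
  [15739820459743735007150080, 36522863886343966090592256, 16807617692332745293824000, 0, 0, 0,
  0, 0, 0, 0, 0, 0, 0, 0, 0, 0, 16849286750903864058183680, 8704564000401940079968256,
  119994374146096925507584, 0, 0, 928638784972146262147072]], [[], [], [], [], [], [], [], [],
  [], [], [], [], [], [], [], [], [], [], [-7869690665710974670995456, 0, 0, 0, 0,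
  50949591613460370157469696, 0, 0, 0, 0, 0, 0, 0, 0, 0, 0, 16579330861209566312398848, 0, 0,
  757972111752068891410432, 0, 953729556157357728202752]]], [[], [], [], [], [], [], [], [], [],
  [], [[], [], [], [], [], [], [], [], [], [], [], [], [], [], [], [], [], [], [], [],
  [400392753340108943292104704, 0, 0, 0, 0, 0, 0, 0, 0, 0, 0, 0, 0, 0, 0, 0,
  199017779116391026860752896, 0, 0, 0, 0, 8588017516648344150081536]]]]

/-- The values of `krawtchouk`. -/
def krawtchoukTable : List (List (List ℤ)) :=
  [[[1, 0, 0, 0, 0], [1, -1, 0, 0, 0], [1, -2, 1, 0, 0], [1, -3, 3, -1, 0], [1, -4, 6, -4, 1],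
  [1, -5, 10, -10, 5], [1, -6, 15, -20, 15], [1, -7, 21, -35, 35], [1, -8, 28, -56, 70], [1, -9,
  36, -84, 126], [1, -10, 45, -120, 210], [1, -11, 55, -165, 330], [1, -12, 66, -220, 495], [1,
  -13, 78, -286, 715], [1, -14, 91, -364, 1001], [1, -15, 105, -455, 1365], [1, -16, 120, -560,
  1820], [1, -17, 136, -680, 2380], [1, -18, 153, -816, 3060], [1, -19, 171, -969, 3876], [1,
  -20, 190, -1140, 4845]], [[1, 1, 0, 0, 0], [1, 0, -1, 0, 0], [1, -1, -1, 1, 0], [1, -2, 0, 2,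
  -1], [1, -3, 2, 2, -3], [1, -4, 5, 0, -5], [1, -5, 9, -5, -5], [1, -6, 14, -14, 0], [1, -7, 20,
  -28, 14], [1, -8, 27, -48, 42], [1, -9, 35, -75, 90], [1, -10, 44, -110, 165], [1, -11, 54,
  -154, 275], [1, -12, 65, -208, 429], [1, -13, 77, -273, 637], [1, -14, 90, -350, 910], [1, -15,
  104, -440, 1260], [1, -16, 119, -544, 1700], [1, -17, 135, -663, 2244], [1, -18, 152, -798,
  2907]], [[1, 2, 1, 0, 0], [1, 1, -1, -1, 0], [1, 0, -2, 0, 1], [1, -1, -2, 2, 1], [1, -2, -1,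
  4, -1], [1, -3, 1, 5, -5], [1, -4, 4, 4, -10], [1, -5, 8, 0, -14], [1, -6, 13, -8, -14], [1,
  -7, 19, -21, -6], [1, -8, 26, -40, 15], [1, -9, 34, -66, 55], [1, -10, 43, -100, 121], [1, -11,
  53, -143, 221], [1, -12, 64, -196, 364], [1, -13, 76, -260, 560], [1, -14, 89, -336, 820], [1,
  -15, 103, -425, 1156], [1, -16, 118, -528, 1581]], [[1, 3, 3, 1, 0], [1, 2, 0, -2, -1], [1, 1,
  -2, -2, 1], [1, 0, -3, 0, 3], [1, -1, -3, 3, 3], [1, -2, -2, 6, 0], [1, -3, 0, 8, -6], [1, -4,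
  3, 8, -14], [1, -5, 7, 5, -22], [1, -6, 12, -2, -27], [1, -7, 18, -14, -25], [1, -8, 25, -32,
  -11], [1, -9, 33, -57, 21], [1, -10, 42, -90, 78], [1, -11, 52, -132, 168], [1, -12, 63, -184,
  300], [1, -13, 75, -247, 484], [1, -14, 88, -322, 731]], [[1, 4, 6, 4, 1], [1, 3, 2, -2, -3],
  [1, 2, -1, -4, -1], [1, 1, -3, -3, 3], [1, 0, -4, 0, 6], [1, -1, -4, 4, 6], [1, -2, -3, 8, 2],
  [1, -3, -1, 11, -6], [1, -4, 2, 12, -17], [1, -5, 6, 10, -29], [1, -6, 11, 4, -39], [1, -7, 17,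
  -7, -43], [1, -8, 24, -24, -36], [1, -9, 32, -48, -12], [1, -10, 41, -80, 36], [1, -11, 51,
  -121, 116], [1, -12, 62, -172, 237]], [[1, 5, 10, 10, 5], [1, 4, 5, 0, -5], [1, 3, 1, -5, -5],
  [1, 2, -2, -6, 0], [1, 1, -4, -4, 6], [1, 0, -5, 0, 10], [1, -1, -5, 5, 10], [1, -2, -4, 10,
  5], [1, -3, -2, 14, -5], [1, -4, 1, 16, -19], [1, -5, 5, 15, -35], [1, -6, 10, 10, -50], [1,
  -7, 16, 0, -60], [1, -8, 23, -16, -60], [1, -9, 31, -39, -44], [1, -10, 40, -70, -5]], [[1, 6,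
  15, 20, 15], [1, 5, 9, 5, -5], [1, 4, 4, -4, -10], [1, 3, 0, -8, -6], [1, 2, -3, -8, 2], [1, 1,
  -5, -5, 10], [1, 0, -6, 0, 15], [1, -1, -6, 6, 15], [1, -2, -5, 12, 9], [1, -3, -3, 17, -3],
  [1, -4, 0, 20, -20], [1, -5, 4, 20, -40], [1, -6, 9, 16, -60], [1, -7, 15, 7, -76], [1, -8, 22,
  -8, -83]], [[1, 7, 21, 35, 35], [1, 6, 14, 14, 0], [1, 5, 8, 0, -14], [1, 4, 3, -8, -14], [1,
  3, -1, -11, -6], [1, 2, -4, -10, 5], [1, 1, -6, -6, 15], [1, 0, -7, 0, 21], [1, -1, -7, 7, 21],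
  [1, -2, -6, 14, 14], [1, -3, -4, 20, 0], [1, -4, -1, 24, -20], [1, -5, 3, 25, -44], [1, -6, 8,
  22, -69]], [[1, 8, 28, 56, 70], [1, 7, 20, 28, 14], [1, 6, 13, 8, -14], [1, 5, 7, -5, -22], [1,
  4, 2, -12, -17], [1, 3, -2, -14, -5], [1, 2, -5, -12, 9], [1, 1, -7, -7, 21], [1, 0, -8, 0,
  28], [1, -1, -8, 8, 28], [1, -2, -7, 16, 20], [1, -3, -5, 23, 4], [1, -4, -2, 28, -19]], [[1,
  9, 36, 84, 126], [1, 8, 27, 48, 42], [1, 7, 19, 21, -6], [1, 6, 12, 2, -27], [1, 5, 6, -10,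
  -29], [1, 4, 1, -16, -19], [1, 3, -3, -17, -3], [1, 2, -6, -14, 14], [1, 1, -8, -8, 28], [1, 0,
  -9, 0, 36], [1, -1, -9, 9, 36], [1, -2, -8, 18, 27]], [[1, 10, 45, 120, 210], [1, 9, 35, 75,
  90], [1, 8, 26, 40, 15], [1, 7, 18, 14, -25], [1, 6, 11, -4, -39], [1, 5, 5, -15, -35], [1, 4,
  0, -20, -20], [1, 3, -4, -20, 0], [1, 2, -7, -16, 20], [1, 1, -9, -9, 36], [1, 0, -10, 0, 45]],
  [[1, 11, 55, 165, 330], [1, 10, 44, 110, 165], [1, 9, 34, 66, 55], [1, 8, 25, 32, -11], [1, 7,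
  17, 7, -43], [1, 6, 10, -10, -50], [1, 5, 4, -20, -40], [1, 4, -1, -24, -20], [1, 3, -5, -23,
  4], [1, 2, -8, -18, 27]], [[1, 12, 66, 220, 495], [1, 11, 54, 154, 275], [1, 10, 43, 100, 121],
  [1, 9, 33, 57, 21], [1, 8, 24, 24, -36], [1, 7, 16, 0, -60], [1, 6, 9, -16, -60], [1, 5, 3,
  -25, -44], [1, 4, -2, -28, -19]], [[1, 13, 78, 286, 715], [1, 12, 65, 208, 429], [1, 11, 53,
  143, 221], [1, 10, 42, 90, 78], [1, 9, 32, 48, -12], [1, 8, 23, 16, -60], [1, 7, 15, -7, -76],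
  [1, 6, 8, -22, -69]], [[1, 14, 91, 364, 1001], [1, 13, 77, 273, 637], [1, 12, 64, 196, 364],
  [1, 11, 52, 132, 168], [1, 10, 41, 80, 36], [1, 9, 31, 39, -44], [1, 8, 22, 8, -83]], [[1, 15,
  105, 455, 1365], [1, 14, 90, 350, 910], [1, 13, 76, 260, 560], [1, 12, 63, 184, 300], [1, 11,
  51, 121, 116], [1, 10, 40, 70, -5]], [[1, 16, 120, 560, 1820], [1, 15, 104, 440, 1260], [1, 14,
  89, 336, 820], [1, 13, 75, 247, 484], [1, 12, 62, 172, 237]], [[1, 17, 136, 680, 2380], [1, 16,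
  119, 544, 1700], [1, 15, 103, 425, 1156], [1, 14, 88, 322, 731]], [[1, 18, 153, 816, 3060], [1,
  17, 135, 663, 2244], [1, 16, 118, 528, 1581]], [[1, 19, 171, 969, 3876], [1, 18, 152, 798,
  2907]], [[1, 20, 190, 1140, 4845]]]

/-- Upper bounds for `degenerateValue`, indexed by half the distances. -/
def tripleTable : List (List (List ℤ)) :=
  [[], [], [], [], [[], [], [], [], [0, 0, 0, 0, 36298203975501710603540924203008,
  9682239265530107177013133443072, -7826174413414334081609771253760,
  -15716444387091978566726761578496, 31400052010670339790555624505344], [0, 0, 0, 0,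
  9682239265530107177013133443072, 11493975346583209319940401135616,
  -4624379484974990840252141142016, -25432633743822374432809903194112,
  -21166649555744852235146244390912, 22185874416190542925666845720576], [0, 0, 0, 0,
  -7826174413414334081609771253760, -4624379484974990840252141142016,
  800846628195763614451857620992, 4058935233365959138289360306176,
  -4698946725908996529165218873344, -72277654593893848142692394991616,
  -191578310104414370424771265429504], [0, 0, 0, 0, -15716444387091978566726761578496,
  -25432633743822374432809903194112, 4058935233365959138289360306176,
  43213930977772036799364144824320, 28660454181926609719333234933760,
  -144442502366362183234666325082112], [0, 0, 0, 0, 31400052010670339790555624505344,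
  -21166649555744852235146244390912, -4698946725908996529165218873344,
  28660454181926609719333234933760, 294759171200748425231984240885760], [0, 0, 0, 0, 0,
  22185874416190542925666845720576, -72277654593893848142692394991616,
  -144442502366362183234666325082112], [0, 0, 0, 0, 0, 0, -191578310104414370424771265429504]],
  [[], [], [], [], [0, 0, 0, 0, 9682239265530107177013133443072,
  11493975346583209319940401135616, -4624379484974990840252141142016,
  -25432633743822374432809903194112, -21166649555744852235146244390912,
  22185874416190542925666845720576], [0, 0, 0, 0, 11493975346583209319940401135616,
  25741380379378397911561084600320, 9143916399483181054633000828928,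
  -14296777283320372684265019670528, -12380938067021691723345693769728,
  -702251418655855577746416599040, -59535300831949423126409493086208], [0, 0, 0, 0,
  -4624379484974990840252141142016, 9143916399483181054633000828928,
  10868291247600523749077335146496, 10999396244501824023910332497920,
  -2952395919920116387515643985920, -39123147299452222305537655570432], [0, 0, 0, 0,
  -25432633743822374432809903194112, -14296777283320372684265019670528,
  10999396244501824023910332497920, 42157200934813221783942216024064,
  61094345260824288546371082911744], [0, 0, 0, 0, -21166649555744852235146244390912,
  -12380938067021691723345693769728, -2952395919920116387515643985920,
  61094345260824288546371082911744], [0, 0, 0, 0, 22185874416190542925666845720576,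
  -702251418655855577746416599040, -39123147299452222305537655570432], [0, 0, 0, 0, 0,
  -59535300831949423126409493086208]], [[], [], [], [], [0, 0, 0, 0,
  -7826174413414334081609771253760, -4624379484974990840252141142016,
  800846628195763614451857620992, 4058935233365959138289360306176,
  -4698946725908996529165218873344, -72277654593893848142692394991616,
  -191578310104414370424771265429504], [0, 0, 0, 0, -4624379484974990840252141142016,
  9143916399483181054633000828928, 10868291247600523749077335146496,
  10999396244501824023910332497920, -2952395919920116387515643985920,
  -39123147299452222305537655570432], [0, 0, 0, 0, 800846628195763614451857620992,
  10868291247600523749077335146496, 26449488626660635637555851689984,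
  43335511114184014800603932786688, 31191391787896040221369830473728], [0, 0, 0, 0,
  4058935233365959138289360306176, 10999396244501824023910332497920,
  43335511114184014800603932786688, 106456951439300528286927371108352], [0, 0, 0, 0,
  -4698946725908996529165218873344, -2952395919920116387515643985920,
  31191391787896040221369830473728], [0, 0, 0, 0, -72277654593893848142692394991616,
  -39123147299452222305537655570432], [0, 0, 0, 0, -191578310104414370424771265429504]], [[], [],
  [], [], [0, 0, 0, 0, -15716444387091978566726761578496, -25432633743822374432809903194112,
  4058935233365959138289360306176, 43213930977772036799364144824320,
  28660454181926609719333234933760, -144442502366362183234666325082112], [0, 0, 0, 0,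
  -25432633743822374432809903194112, -14296777283320372684265019670528,
  10999396244501824023910332497920, 42157200934813221783942216024064,
  61094345260824288546371082911744], [0, 0, 0, 0, 4058935233365959138289360306176,
  10999396244501824023910332497920, 43335511114184014800603932786688,
  106456951439300528286927371108352], [0, 0, 0, 0, 43213930977772036799364144824320,
  42157200934813221783942216024064, 106456951439300528286927371108352], [0, 0, 0, 0,
  28660454181926609719333234933760, 61094345260824288546371082911744], [0, 0, 0, 0,
  -144442502366362183234666325082112]], [[], [], [], [], [0, 0, 0, 0,
  31400052010670339790555624505344, -21166649555744852235146244390912,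
  -4698946725908996529165218873344, 28660454181926609719333234933760,
  294759171200748425231984240885760], [0, 0, 0, 0, -21166649555744852235146244390912,
  -12380938067021691723345693769728, -2952395919920116387515643985920,
  61094345260824288546371082911744], [0, 0, 0, 0, -4698946725908996529165218873344,
  -2952395919920116387515643985920, 31191391787896040221369830473728], [0, 0, 0, 0,
  28660454181926609719333234933760, 61094345260824288546371082911744], [0, 0, 0, 0,
  294759171200748425231984240885760]], [[], [], [], [], [0, 0, 0, 0, 0,
  22185874416190542925666845720576, -72277654593893848142692394991616,
  -144442502366362183234666325082112], [0, 0, 0, 0, 22185874416190542925666845720576,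
  -702251418655855577746416599040, -39123147299452222305537655570432], [0, 0, 0, 0,
  -72277654593893848142692394991616, -39123147299452222305537655570432], [0, 0, 0, 0,
  -144442502366362183234666325082112]], [[], [], [], [], [0, 0, 0, 0, 0, 0,
  -191578310104414370424771265429504], [0, 0, 0, 0, 0, -59535300831949423126409493086208], [0, 0,
  0, 0, -191578310104414370424771265429504]]]

/-- The values of `pairValue`, indexed by half the distance. -/
def pairTable : List ℤ :=
  [0,
  0,
  0,
  0,
  836154314509016715431247872,
  705347599111644226319089664,
  -423625926242665710071119872,
  1394379874083046209882193920,
  34580455172190557308780544000,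
  60815138931022169586431688704,
  459754090813659796668353085440]

/-- The `n`-th entry of a list, or the default value `d` past its end. -/
def nth {α : Type} (d : α) : List α → ℕ → α
  | [], _ => d
  | x :: _, 0 => x
  | _ :: l, n + 1 => nth d l n

/-- Whether `f k` holds for all `k < n`. -/
def allBelow (f : ℕ → Bool) : ℕ → Bool
  | 0 => true
  | n + 1 => f n && allBelow f n

/-- The (unnormalised) Hahn-type kernel of degree `l`, as a function of the four sizes in which two
subsets partition a finite set. -/
def hahn : ℕ → ℕ → ℕ → ℕ → ℕ → ℤ
  | 0, _, _, _, _ => 1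
  | l + 1, a, b, c, e =>
    (a * e : ℕ) * hahn l (a - 1) b c (e - 1) - (b * c : ℕ) * hahn l a (b - 1) (c - 1) e

/-- The entry of a certificate vector at `(p, q)`. -/
def entry (v : List (List ℤ)) (p q : ℕ) : ℤ :=
  bif Nat.beq (p % 2) 0 then nth 0 (nth [] v (p / 2)) (q / 2) else 0

/-- The Gram matrix of the rows of the list `vs`. -/
def gram (p p' q q' : ℕ) : List (List (List ℤ)) → ℤ
  | [] => 0
  | v :: vs => entry v p q * entry v p' q' + gram p p' q q' vs

/-- A nonnegative combination of Hahn kernels with Gram matrix coefficients. -/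
def blockSum (p p' q q' a b c e : ℕ) : List (ℕ × ℕ × List (List (List ℤ))) → ℤ
  | [] => 0
  | x :: xs => x.2.1 * (gram p p' q q' x.2.2 * hahn x.1 a b c e) + blockSum p p' q q' a b c e xs

/-- The weight of a set `s` of size `m` in `kernel`. -/
def weight (m p p' q q' t : ℕ) : ℤ :=
  blockSum p p' q q' t (q - t) (q' - t) (20 + t - m - q - q') (nth [] certificate m)

/-- The weight in terms of the sizes of the intersections of `s` with the four atoms generated
by two sets of sizes `D`, `D'` whose intersection has size `t`. -/
def splitWeight (D D' t : ℕ) (a : ℕ × ℕ × ℕ × ℕ) : ℤ :=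
  bif Nat.ble a.2.2.2 t && Nat.ble a.2.2.1 (D - t) && Nat.ble a.2.1 (D' - t) &&
      Nat.ble a.1 (20 + t - D - D') then
    weight (a.1 + a.2.1 + a.2.2.1 + a.2.2.2) (a.2.2.1 + a.2.2.2) (a.2.1 + a.2.2.2)
      (D - a.2.2.1 - a.2.2.2) (D' - a.2.1 - a.2.2.2) (t - a.2.2.2)
  else 0

/-- Krawtchouk-type numbers: the coefficient of `X ^ a` in `(1 + X) ^ n * (1 - X) ^ k`. -/
def krawtchouk (n : ℕ) : ℕ → ℕ → ℤ
  | 0, a => n.choose a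
  | _ + 1, 0 => 1
  | k + 1, a + 1 => krawtchouk n k (a + 1) - krawtchouk n k a

/-- The tabulated values of `krawtchouk`. -/
def krawtchoukRow (n k : ℕ) : List ℤ := nth [] (nth [] krawtchoukTable n) k

/-- The tabulated values of `splitWeight`. -/
def weightRow (D D' t : ℕ) : List ℤ := nth [] (nth [] (nth [] kernelTable (D / 2)) (D' / 2)) t

/-- The summand of `contract`. -/
def contractTerm (r₀ r₁ r₂ r₃ : List ℤ) (a : ℕ × ℕ × ℕ × ℕ) (x : ℤ) : ℤ :=
  x * (nth 0 r₀ a.1 * nth 0 r₁ a.2.1 * (nth 0 r₂ a.2.2.1 * nth 0 r₃ a.2.2.2))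

/-- Contraction of a row of weights with four rows of Krawtchouk numbers. -/
def contract (r₀ r₁ r₂ r₃ : List ℤ) : List (ℕ × ℕ × ℕ × ℕ) → List ℤ → ℤ
  | a :: as, x :: xs => contractTerm r₀ r₁ r₂ r₃ a x + contract r₀ r₁ r₂ r₃ as xs
  | _, _ => 0

/-- The value of `kernel` in terms of the numbers of columns of each type. -/
def typeKernel (n₀ p₁ p₂ p₃ p₄ q₂ q₃ q₄ : ℕ) : ℤ :=
  bif Nat.ble (p₁ + p₂) (p₃ + p₄) then
    contract (krawtchoukRow n₀ q₂) (krawtchoukRow p₄ p₃) (krawtchoukRow p₂ p₁)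
      (krawtchoukRow q₃ q₄) splitList (weightRow (p₁ + p₂ + q₃ + q₄) (p₃ + p₄ + q₃ + q₄) (q₃ + q₄))
  else
    contract (krawtchoukRow n₀ q₂) (krawtchoukRow p₂ p₁) (krawtchoukRow p₄ p₃)
      (krawtchoukRow q₃ q₄) splitList (weightRow (p₃ + p₄ + q₃ + q₄) (p₁ + p₂ + q₃ + q₄) (q₃ + q₄))

/-- The contribution of the degenerate quadruples made of two words at distance `d`. -/
def pairValue (d : ℕ) : ℤ :=
  typeKernel (20 - d) 0 0 0 0 d 0 0 + typeKernel (20 - d) 0 0 0 0 0 d 0 +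
    typeKernel (20 - d) 0 0 0 0 0 0 d + typeKernel (20 - d) 0 0 0 d 0 0 0 +
    typeKernel (20 - d) 0 0 d 0 0 0 0 + typeKernel (20 - d) 0 d 0 0 0 0 0 +
    typeKernel (20 - d) d 0 0 0 0 0 0

/-- The tabulated values of `pairValue`. -/
def pairEntry (d : ℕ) : ℤ := nth 0 pairTable (d / 2)

/-- The contribution of the degenerate quadruples made of three words `a`, `b`, `c` which repeat
`a`, where `x = #{b ≠ a = c}`, `y = #{c ≠ a = b}`, `z = #{b = c ≠ a}`. -/
def tripleValue (x y z : ℕ) : ℤ :=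
  4 * typeKernel (20 - x - y - z) 0 0 x y z 0 0 + 8 * typeKernel (20 - x - y - z) 0 x 0 y 0 z 0

/-- The symmetrised contribution of all degenerate quadruples in three words which are the
exception in `x`, `y`, `z` columns respectively. -/
def degenerateValue (x y z : ℕ) : ℤ :=
  256 * 255 * (tripleValue y z x + tripleValue x z y + tripleValue x y z) +
    256 * 2 * (pairEntry (x + y) + pairEntry (x + z) + pairEntry (y + z)) +
    6 * typeKernel 20 0 0 0 0 0 0 0

/-- The tabulated upper bounds for `degenerateValue` in terms of the distances. -/
def tripleBound (d d' d'' : ℕ) : ℤ :=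
  nth 0 (nth [] (nth [] tripleTable (d / 2)) (d' / 2)) (d'' / 2)

/-- The upper bound for the symmetrised contribution of a quadruple of distinct words. -/
def quadBound (n₀ p₁ p₂ p₃ p₄ q₂ q₃ q₄ : ℕ) : ℤ :=
  8 * (256 * 255 * 254) * (typeKernel n₀ p₁ p₂ p₃ p₄ q₂ q₃ q₄ +
      typeKernel n₀ p₁ p₃ p₂ p₄ q₃ q₂ q₄ + typeKernel n₀ p₁ p₄ p₃ p₂ q₄ q₃ q₂) +
    (tripleBound (p₁ + p₂ + q₃ + q₄) (p₁ + p₃ + q₂ + q₄) (p₂ + p₃ + q₂ + q₃) +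
    tripleBound (p₁ + p₂ + q₃ + q₄) (p₁ + p₄ + q₂ + q₃) (p₂ + p₄ + q₂ + q₄) +
    tripleBound (p₁ + p₃ + q₂ + q₄) (p₁ + p₄ + q₂ + q₃) (p₃ + p₄ + q₃ + q₄) +
    tripleBound (p₂ + p₃ + q₂ + q₃) (p₂ + p₄ + q₂ + q₄) (p₃ + p₄ + q₃ + q₄))

/-- Whether `d` is an admissible distance between distinct words. -/
def isDistance (d : ℕ) : Bool := Nat.beq (d % 2) 0 && Nat.ble 8 d

/-- Whether an integer is negative. -/
def isNeg : ℤ → Bool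
  | Int.ofNat _ => false
  | Int.negSucc _ => true

/-- The Krawtchouk table is correct. -/
def checkKrawtchouk : Bool :=
  allBelow (fun n => allBelow (fun k => Nat.ble 21 (n + k) ||
    allBelow (fun a => decide (nth 0 (krawtchoukRow n k) a = krawtchouk n k a)) 5) 21) 21

/-- The table of weights is correct. -/
def checkWeights : Bool :=
  allBelow (fun D => !(Nat.beq D 0 || isDistance D) ||
    allBelow (fun D' => !(Nat.ble D D' && (Nat.beq D' 0 || isDistance D')) ||
      allBelow (fun t => !(Nat.ble t D && Nat.ble (D + D') (20 + t)) ||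
        decide (weightRow D D' t = splitList.map (splitWeight D D' t))) 21) 21) 21

/-- The table of contributions of pairs is correct. -/
def checkPairs : Bool :=
  allBelow (fun d => !(isDistance d) || decide (pairEntry d = pairValue d)) 21

/-- The table of bounds for triples is correct. -/
def checkTriples : Bool :=
  allBelow (fun x => allBelow (fun y => !(isDistance (x + y)) ||
    allBelow (fun z => !(isDistance (x + z) && isDistance (y + z) && Nat.ble (x + y + z) 20) ||
      !(isNeg (tripleBound (x + y) (x + z) (y + z) - degenerateValue x y z))) 21) 21) 21

/-- All quadruples contribute negatively. -/
def checkQuads : Bool :=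
  allBelow (fun q₂ => allBelow (fun q₃ => allBelow (fun q₄ =>
  allBelow (fun p₁ =>
  allBelow (fun p₂ => !(Nat.ble p₁ p₂ && isDistance (p₁ + p₂ + q₃ + q₄)) ||
  allBelow (fun p₃ => !(Nat.ble p₂ p₃ && isDistance (p₁ + p₃ + q₂ + q₄) &&
    isDistance (p₂ + p₃ + q₂ + q₃)) ||
  allBelow (fun p₄ => !(Nat.ble p₃ p₄ && isDistance (p₁ + p₄ + q₂ + q₃) &&
    isDistance (p₂ + p₄ + q₂ + q₄) && isDistance (p₃ + p₄ + q₃ + q₄)) ||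
    isNeg (quadBound (20 - (p₁ + p₂ + p₃ + p₄ + q₂ + q₃ + q₄)) p₁ p₂ p₃ p₄ q₂ q₃ q₄))
  (21 - (q₂ + q₃ + q₄ + p₁ + p₂ + p₃)))
  (21 - (q₂ + q₃ + q₄ + p₁ + p₂)))
  (21 - (q₂ + q₃ + q₄ + p₁)))
  (21 - (q₂ + q₃ + q₄)))
  (21 - (q₂ + q₃))) (21 - q₂)) 21

theorem checkKrawtchouk_eq_true : checkKrawtchouk = true := by decide +kernel

theorem checkWeights_eq_true : checkWeights = true := by decide +kernel

theorem checkPairs_eq_true : checkPairs = true := by decide +kernel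

theorem checkTriples_eq_true : checkTriples = true := by decide +kernel

theorem checkQuads_eq_true : checkQuads = true := by decide +kernel

/-- The number of elements of `A` on which `f` and `g` take the values `u` and `v`. -/
def jointCount {α : Type*} (A : Finset α) (f g : α → Bool) (u v : Bool) : ℕ :=
  (A.filter fun i => f i = u ∧ g i = v).card

theorem jointCount_erase_of_eq {α : Type*} [DecidableEq α] {A : Finset α} {f g : α → Bool}
    {u v : Bool} {a : α} (ha : a ∈ A) (h : f a = u ∧ g a = v) :
    jointCount (A.erase a) f g u v = jointCount A f g u v - 1 := by
  unfold jointCount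
  rw [Finset.filter_erase, Finset.card_erase_of_mem (by simp [ha, h])]

theorem jointCount_erase_of_ne {α : Type*} [DecidableEq α] {A : Finset α} {f g : α → Bool}
    {u v : Bool} {a : α} (h : ¬(f a = u ∧ g a = v)) :
    jointCount (A.erase a) f g u v = jointCount A f g u v := by
  unfold jointCount
  rw [Finset.filter_erase, Finset.erase_eq_of_notMem (by simp_all)]

/-- `hahn` evaluated at the sizes of the parts into which `f` and `g` partition `A`. -/
def hahnOn {α : Type*} (l : ℕ) (A : Finset α) (f g : α → Bool) : ℤ :=
  hahn l (jointCount A f g true true) (jointCount A f g true false) (jointCount A f g false true)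
    (jointCount A f g false false)

/-- The difference of the indicator of `f` at two points. -/
def indicatorDiff {α : Type*} (f : α → Bool) (a b : α) : ℤ := (f a).toNat - (f b).toNat

theorem sum_indicatorDiff_mul_hahnOn {α : Type*} [DecidableEq α] (l : ℕ) (A : Finset α)
    (f g : α → Bool) :
    ∑ a ∈ A, ∑ b ∈ A, indicatorDiff f a b * indicatorDiff g a b *
      hahnOn l ((A.erase a).erase b) f g = 2 * hahnOn (l + 1) A f g := by
  have key : ∀ a ∈ A, ∀ b ∈ A, indicatorDiff f a b * indicatorDiff g a b *
      hahnOn l ((A.erase a).erase b) f g =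
      ((if f a = true ∧ g a = true then 1 else 0) * (if f b = false ∧ g b = false then 1 else 0) +
      (if f a = false ∧ g a = false then 1 else 0) * (if f b = true ∧ g b = true then 1 else 0)) *
        hahn l (jointCount A f g true true - 1) (jointCount A f g true false)
          (jointCount A f g false true) (jointCount A f g false false - 1) -
      ((if f a = true ∧ g a = false then 1 else 0) * (if f b = false ∧ g b = true then 1 else 0) +
      (if f a = false ∧ g a = true then 1 else 0) * (if f b = true ∧ g b = false then 1 else 0)) *
        hahn l (jointCount A f g true true) (jointCount A f g true false - 1)
          (jointCount A f g false true - 1) (jointCount A f g false false) := by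
    intro a ha b hb
    by_cases hab : a = b
    · subst hab
      rcases hfa : f a <;> rcases hga : g a <;> simp [indicatorDiff]
    have hb' : b ∈ A.erase a := Finset.mem_erase.2 ⟨Ne.symm hab, hb⟩
    unfold hahnOn
    have h : ∀ u v, jointCount ((A.erase a).erase b) f g u v =
        jointCount A f g u v - (if f a = u ∧ g a = v then 1 else 0) -
          (if f b = u ∧ g b = v then 1 else 0) := by
      intro u v
      by_cases h1 : f b = u ∧ g b = v
      · rw [jointCount_erase_of_eq hb' h1]
        by_cases h2 : f a = u ∧ g a = v
        · rw [jointCount_erase_of_eq ha h2, if_pos h2, if_pos h1]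
        · rw [jointCount_erase_of_ne h2, if_neg h2, if_pos h1, Nat.sub_zero]
      · rw [jointCount_erase_of_ne h1]
        by_cases h2 : f a = u ∧ g a = v
        · rw [jointCount_erase_of_eq ha h2, if_pos h2, if_neg h1, Nat.sub_zero]
        · rw [jointCount_erase_of_ne h2, if_neg h2, if_neg h1, Nat.sub_zero, Nat.sub_zero]
    rw [h, h, h, h]
    rcases hfa : f a <;> rcases hga : g a <;> rcases hfb : f b <;> rcases hgb : g b <;>
      simp [indicatorDiff, hfa, hga, hfb, hgb]
  have hc : ∀ u v, ∑ a ∈ A, (if f a = u ∧ g a = v then (1 : ℤ) else 0) = jointCount A f g u v := by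
    intro u v
    simp [jointCount]
  rw [Finset.sum_congr rfl fun a ha => Finset.sum_congr rfl (key a ha)]
  simp only [Finset.sum_sub_distrib, ← Finset.sum_mul, Finset.sum_add_distrib, ← Finset.mul_sum, hc]
  simp only [hahnOn, hahn]
  push_cast
  ring

theorem sum_hahnOn_nonneg {α ι : Type*} [DecidableEq α] (l : ℕ) (A : Finset α) (J : Finset ι)
    (f : ι → α → Bool) (ω : ι → ℤ) :
    0 ≤ ∑ i ∈ J, ∑ j ∈ J, ω i * ω j * hahnOn l A (f i) (f j) := by
  induction l generalizing A ω with
  | zero =>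
    simp only [hahnOn, hahn, mul_one, ← Finset.sum_mul_sum]
    exact mul_self_nonneg _
  | succ l ih =>
    have h : 2 * ∑ i ∈ J, ∑ j ∈ J, ω i * ω j * hahnOn (l + 1) A (f i) (f j) =
        ∑ a ∈ A, ∑ b ∈ A, ∑ i ∈ J, ∑ j ∈ J, (ω i * indicatorDiff (f i) a b) *
          (ω j * indicatorDiff (f j) a b) * hahnOn l ((A.erase a).erase b) (f i) (f j) := by
      rw [Finset.mul_sum]
      simp_rw [Finset.sum_comm (s := A) (t := J)]
      refine Finset.sum_congr rfl fun i _ => ?_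
      rw [Finset.mul_sum]
      refine Finset.sum_congr rfl fun j _ => ?_
      rw [mul_left_comm, ← sum_indicatorDiff_mul_hahnOn, Finset.mul_sum]
      refine Finset.sum_congr rfl fun a _ => ?_
      rw [Finset.mul_sum]
      refine Finset.sum_congr rfl fun b _ => ?_
      ring
    have h' := Finset.sum_nonneg fun a (_ : a ∈ A) => Finset.sum_nonneg fun b (_ : b ∈ A) =>
      ih ((A.erase a).erase b) fun i => ω i * indicatorDiff (f i) a b
    rw [← h] at h'
    linarith

theorem hahn_symm (l a b c e : ℕ) : hahn l a b c e = hahn l a c b e := by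
  induction l generalizing a b c e with
  | zero => rfl
  | succ l ih => rw [hahn, hahn, ih, ih a, Nat.mul_comm b c]

/-- The number of elements of `A` on which `f` is true. -/
def trueCount {α : Type*} (A : Finset α) (f : α → Bool) : ℕ := (A.filter fun i => f i = true).card

/-- The indicator of the coordinates in which two words differ. -/
def differ (x y : Fin 20 → Bool) : Fin 20 → Bool := fun i => xor (x i) (y i)

/-- The sign `(-1) ^ b`. -/
def boolSign (b : Bool) : ℤ := bif b then -1 else 1

/-- The value at `x` of the character of `(ℤ/2) ^ 20` attached to `s`. -/
def character (s : Finset (Fin 20)) (x : Fin 20 → Bool) : ℤ := ∏ i ∈ s, boolSign (x i)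

/-- The contribution of a set `s` to `kernel`. -/
def weightAt (s : Finset (Fin 20)) (f g : Fin 20 → Bool) : ℤ :=
  weight s.card (trueCount s f) (trueCount s g) (trueCount sᶜ f) (trueCount sᶜ g)
    (jointCount sᶜ f g true true)

/-- A positive semidefinite kernel on pairs of words. -/
def kernel (x y x' y' : Fin 20 → Bool) : ℤ :=
  ∑ s : Finset (Fin 20), character s x * character s x' * weightAt s (differ x y) (differ x' y')

theorem jointCount_true_false {α : Type*} (A : Finset α) (f g : α → Bool) :
    jointCount A f g true false = trueCount A f - jointCount A f g true true := by
  have h := Finset.card_filter_add_card_filter_not (s := A.filter fun i => f i = true)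
    (fun i => g i = true)
  simp only [Finset.filter_filter, Bool.not_eq_true] at h
  unfold jointCount trueCount
  omega

theorem jointCount_comm {α : Type*} (A : Finset α) (f g : α → Bool) (u v : Bool) :
    jointCount A f g u v = jointCount A g f v u := by
  simp only [jointCount, and_comm]

theorem jointCount_false_true {α : Type*} (A : Finset α) (f g : α → Bool) :
    jointCount A f g false true = trueCount A g - jointCount A f g true true := by
  rw [jointCount_comm, jointCount_true_false, jointCount_comm]

theorem jointCount_false_false {α : Type*} (A : Finset α) (f g : α → Bool) :
    A.card + jointCount A f g true true =
      jointCount A f g false false + trueCount A f + trueCount A g := by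
  have h := Finset.card_filter_add_card_filter_not (s := A) (fun i => f i = true)
  have h₁ := Finset.card_filter_add_card_filter_not (s := A.filter fun i => f i = true)
    (fun i => g i = true)
  have h₂ := Finset.card_filter_add_card_filter_not (s := A.filter fun i => f i = false)
    (fun i => g i = true)
  have h₃ := jointCount_false_true A f g
  have h₄ : jointCount A f g true true ≤ trueCount A g :=
    Finset.card_le_card fun i hi => by simp_all
  simp only [Finset.filter_filter, Bool.not_eq_true] at h h₁ h₂
  unfold jointCount trueCount at *
  omega

theorem weightAt_eq (s : Finset (Fin 20)) (f g : Fin 20 → Bool) :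
    weightAt s f g = blockSum (trueCount s f) (trueCount s g) (trueCount sᶜ f) (trueCount sᶜ g)
      (jointCount sᶜ f g true true) (jointCount sᶜ f g true false) (jointCount sᶜ f g false true)
      (jointCount sᶜ f g false false) (nth [] certificate s.card) := by
  have h : 20 + jointCount sᶜ f g true true - s.card - trueCount sᶜ f - trueCount sᶜ g =
      jointCount sᶜ f g false false := by
    have h₁ := Finset.card_add_card_compl s
    have h₂ := jointCount_false_false sᶜ f g
    rw [Fintype.card_fin] at h₁
    omega
  rw [weightAt, weight, h, jointCount_true_false, jointCount_false_true]

theorem sum_gram_nonneg {ι : Type*} (J : Finset ι) (A : Finset (Fin 20)) (l : ℕ) (ω : ι → ℤ)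
    (f : ι → Fin 20 → Bool) (p q : ι → ℕ) (vs : List (List (List ℤ))) :
    0 ≤ ∑ i ∈ J, ∑ j ∈ J, ω i * ω j *
      (gram (p i) (p j) (q i) (q j) vs * hahnOn l A (f i) (f j)) := by
  induction vs with
  | nil => simp [gram]
  | cons v vs ih =>
    refine (add_nonneg (sum_hahnOn_nonneg l A J f fun i => ω i * entry v (p i) (q i)) ih).trans_eq ?_
    simp only [← Finset.sum_add_distrib]
    refine Finset.sum_congr rfl fun i _ => Finset.sum_congr rfl fun j _ => ?_
    rw [gram]
    ring

theorem sum_blockSum_nonneg {ι : Type*} (J : Finset ι) (A : Finset (Fin 20)) (ω : ι → ℤ)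
    (f : ι → Fin 20 → Bool) (p q : ι → ℕ) (bs : List (ℕ × ℕ × List (List (List ℤ)))) :
    0 ≤ ∑ i ∈ J, ∑ j ∈ J, ω i * ω j *
      blockSum (p i) (p j) (q i) (q j) (jointCount A (f i) (f j) true true)
        (jointCount A (f i) (f j) true false) (jointCount A (f i) (f j) false true)
        (jointCount A (f i) (f j) false false) bs := by
  induction bs with
  | nil => simp [blockSum]
  | cons b bs ih =>
    refine (add_nonneg (mul_nonneg (Int.natCast_nonneg b.2.1)
      (sum_gram_nonneg J A b.1 ω f p q b.2.2)) ih).trans_eq ?_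
    simp only [Finset.mul_sum, ← Finset.sum_add_distrib]
    refine Finset.sum_congr rfl fun i _ => Finset.sum_congr rfl fun j _ => ?_
    rw [blockSum, hahnOn]
    ring

theorem sum_kernel_nonneg (C : Finset (Fin 20 → Bool)) :
    0 ≤ ∑ x ∈ C, ∑ y ∈ C, ∑ x' ∈ C, ∑ y' ∈ C, kernel x y x' y' := by
  have h : ∑ x ∈ C, ∑ y ∈ C, ∑ x' ∈ C, ∑ y' ∈ C, kernel x y x' y' =
      ∑ s : Finset (Fin 20), ∑ i ∈ C ×ˢ C, ∑ j ∈ C ×ˢ C, character s i.1 * character s j.1 *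
        weightAt s (differ i.1 i.2) (differ j.1 j.2) := by
    simp only [Finset.sum_product, kernel]
    simp_rw [Finset.sum_comm (s := (Finset.univ : Finset (Finset (Fin 20))))]
  rw [h]
  refine Finset.sum_nonneg fun s _ => ?_
  simp only [weightAt_eq]
  exact sum_blockSum_nonneg (C ×ˢ C) sᶜ (fun i => character s i.1) (fun i => differ i.1 i.2)
    (fun i => trueCount s (differ i.1 i.2)) (fun i => trueCount sᶜ (differ i.1 i.2)) _

theorem gram_symm (p p' q q' : ℕ) (vs : List (List (List ℤ))) :
    gram p p' q q' vs = gram p' p q' q vs := by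
  induction vs with
  | nil => rfl
  | cons v vs ih => rw [gram, gram, ih, mul_comm]

theorem blockSum_symm (p p' q q' a b c e : ℕ) (bs : List (ℕ × ℕ × List (List (List ℤ)))) :
    blockSum p p' q q' a b c e bs = blockSum p' p q' q a c b e bs := by
  induction bs with
  | nil => rfl
  | cons x xs ih => rw [blockSum, blockSum, ih, hahn_symm, gram_symm]

theorem weightAt_symm (s : Finset (Fin 20)) (f g : Fin 20 → Bool) :
    weightAt s f g = weightAt s g f := by
  rw [weightAt_eq, weightAt_eq, blockSum_symm, jointCount_comm, jointCount_comm _ _ _ true false,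
    jointCount_comm _ _ _ false true, jointCount_comm _ _ _ false false]

theorem gram_eq_zero {p : ℕ} (hp : p % 2 = 1) (p' q q' : ℕ) (vs : List (List (List ℤ))) :
    gram p p' q q' vs = 0 := by
  induction vs with
  | nil => rfl
  | cons v vs ih =>
    have h : entry v p q = 0 := by
      rw [entry, hp]
      rfl
    rw [gram, ih, h, zero_mul, zero_add]

theorem blockSum_eq_zero {p : ℕ} (hp : p % 2 = 1) (p' q q' a b c e : ℕ)
    (bs : List (ℕ × ℕ × List (List (List ℤ)))) : blockSum p p' q q' a b c e bs = 0 := by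
  induction bs with
  | nil => rfl
  | cons x xs ih => rw [blockSum, ih, gram_eq_zero hp]; simp

theorem kernel_exchange (x y x' y' : Fin 20 → Bool) : kernel x y x' y' = kernel x' y' x y := by
  unfold kernel
  refine Finset.sum_congr rfl fun s _ => ?_
  rw [weightAt_symm, mul_comm (character s x)]

theorem differ_comm (x y : Fin 20 → Bool) : differ x y = differ y x := by
  funext i
  exact Bool.xor_comm _ _

theorem boolSign_xor (a b : Bool) : boolSign (xor a b) = boolSign a * boolSign b := by
  cases a <;> cases b <;> rfl

theorem character_mul (s : Finset (Fin 20)) (x y : Fin 20 → Bool) :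
    character s x * character s y = character s (differ x y) := by
  simp only [character, differ, boolSign_xor, Finset.prod_mul_distrib]

theorem character_eq (s : Finset (Fin 20)) (f : Fin 20 → Bool) :
    character s f = (-1) ^ trueCount s f := by
  have h : ∀ i, boolSign (f i) = if f i = true then -1 else 1 := fun i => by
    cases f i <;> rfl
  simp only [character, h, Finset.prod_ite, Finset.prod_const, one_pow, mul_one]
  rfl

theorem character_mul_self (s : Finset (Fin 20)) (x : Fin 20 → Bool) :
    character s x * character s x = 1 := by
  have h : ∀ b, boolSign b * boolSign b = 1 := by decide
  simp only [character, ← Finset.prod_mul_distrib, h, Finset.prod_const_one]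

theorem kernel_swap_left (x y x' y' : Fin 20 → Bool) : kernel x y x' y' = kernel y x x' y' := by
  unfold kernel
  refine Finset.sum_congr rfl fun s _ => ?_
  rw [differ_comm y x]
  rcases Nat.mod_two_eq_zero_or_one (trueCount s (differ x y)) with h | h
  · have h₁ : character s x * character s y = 1 := by
      rw [character_mul, character_eq]
      exact Even.neg_one_pow (Nat.even_iff.2 h)
    have h₂ : character s x = character s y := by
      rw [← mul_one (character s x), ← character_mul_self s y, ← mul_assoc, h₁, one_mul]
    rw [h₂]
  · rw [weightAt_eq, blockSum_eq_zero h, mul_zero, mul_zero]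

theorem kernel_swap_right (x y x' y' : Fin 20 → Bool) : kernel x y x' y' = kernel x y y' x' := by
  rw [kernel_exchange, kernel_swap_left, kernel_exchange]

theorem sum_powerset_union {α : Type*} [DecidableEq α] {A B : Finset α} (h : Disjoint A B)
    (F : Finset α → ℤ) :
    ∑ s ∈ (A ∪ B).powerset, F s = ∑ s ∈ A.powerset, ∑ t ∈ B.powerset, F (s ∪ t) := by
  induction A using Finset.induction_on generalizing F with
  | empty => simp
  | insert a A ha ih =>
    rw [Finset.disjoint_insert_left] at h
    rw [Finset.insert_union, Finset.sum_powerset_insert (by simp [ha, h.1]),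
      Finset.sum_powerset_insert ha, ih h.2, ih h.2 fun s => F (insert a s)]
    simp only [Finset.insert_union]

/-- The sum of the characters of the subsets of `A` of size `a`. -/
def characterSum (h : Fin 20 → Bool) (A : Finset (Fin 20)) (a : ℕ) : ℤ :=
  ∑ s ∈ A.powersetCard a, character s h

theorem characterSum_eq (h : Fin 20 → Bool) (P M : Finset (Fin 20)) (hP : ∀ i ∈ P, h i = false)
    (hM : ∀ i ∈ M, h i = true) (a : ℕ) :
    characterSum h (P ∪ M) a = krawtchouk P.card M.card a := by
  induction M using Finset.induction_on generalizing a with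
  | empty =>
    rw [Finset.union_empty, Finset.card_empty, krawtchouk, characterSum, ← Finset.card_powersetCard,
      Finset.card_eq_sum_ones, Nat.cast_sum]
    refine Finset.sum_congr rfl fun s hs => Finset.prod_eq_one fun i hi => ?_
    rw [hP i ((Finset.mem_powersetCard.1 hs).1 hi)]
    rfl
  | insert i M hi ih =>
    have hi' : i ∉ P ∪ M := by
      intro hmem
      rcases Finset.mem_union.1 hmem with hmem | hmem
      · have h₁ := hP i hmem
        have h₂ := hM i (Finset.mem_insert_self i M)
        simp_all
      · exact hi hmem
    have ih' := ih fun j hj => hM j (Finset.mem_insert_of_mem hj)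
    rw [Finset.card_insert_of_notMem hi, Finset.union_insert]
    cases a with
    | zero => simp [characterSum, krawtchouk, character]
    | succ a =>
      rw [krawtchouk, ← ih', ← ih', characterSum, Finset.powersetCard_succ_insert hi',
        Finset.sum_union, sub_eq_add_neg]
      · congr 1
        rw [Finset.sum_image, characterSum, ← Finset.sum_neg_distrib]
        · refine Finset.sum_congr rfl fun s hs => ?_
          have his : i ∉ s := fun h => hi' ((Finset.mem_powersetCard.1 hs).1 h)
          rw [character, Finset.prod_insert his, hM i (Finset.mem_insert_self i M)]
          exact neg_one_mul _
        · intro s hs t ht hst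
          have his : i ∉ s := fun h => hi' ((Finset.mem_powersetCard.1 hs).1 h)
          have hit : i ∉ t := fun h => hi' ((Finset.mem_powersetCard.1 ht).1 h)
          rw [← Finset.erase_insert his, ← Finset.erase_insert hit]
          exact congrArg (fun r => r.erase i) hst
      · rw [Finset.disjoint_left]
        intro s hs hs'
        obtain ⟨t, -, rfl⟩ := Finset.mem_image.1 hs'
        exact hi' ((Finset.mem_powersetCard.1 hs).1 (Finset.mem_insert_self i t))

theorem sum_powerset_character (h : Fin 20 → Bool) (A : Finset (Fin 20)) (G : ℕ → ℤ)
    (hG : ∀ a, 5 ≤ a → G a = 0) :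
    ∑ s ∈ A.powerset, character s h * G s.card =
      ∑ a ∈ Finset.range 5, characterSum h A a * G a := by
  have h₁ : ∀ a, characterSum h A a * G a =
      ∑ s ∈ A.powerset, if s.card = a then character s h * G s.card else 0 := by
    intro a
    rw [← Finset.sum_filter, ← Finset.powersetCard_eq_filter, characterSum, Finset.sum_mul]
    refine Finset.sum_congr rfl fun s hs => ?_
    rw [(Finset.mem_powersetCard.1 hs).2]
  simp only [h₁]
  rw [Finset.sum_comm]
  refine Finset.sum_congr rfl fun s _ => ?_
  rw [Finset.sum_ite_eq]
  split_ifs with hs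
  · rfl
  · rw [hG _ (by simpa using hs), mul_zero]

theorem sum_powerset_character_four (h : Fin 20 → Bool) (A₀ A₁ A₂ A₃ : Finset (Fin 20))
    (G : ℕ → ℕ → ℕ → ℕ → ℤ)
    (hG : ∀ a b c d, 5 ≤ a ∨ 5 ≤ b ∨ 5 ≤ c ∨ 5 ≤ d → G a b c d = 0) :
    ∑ s₀ ∈ A₀.powerset, ∑ s₁ ∈ A₁.powerset, ∑ s₂ ∈ A₂.powerset, ∑ s₃ ∈ A₃.powerset,
      character s₀ h * (character s₁ h * (character s₂ h * (character s₃ h *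
        G s₀.card s₁.card s₂.card s₃.card))) =
    ∑ a ∈ Finset.range 5, ∑ b ∈ Finset.range 5, ∑ c ∈ Finset.range 5, ∑ d ∈ Finset.range 5,
      characterSum h A₀ a * (characterSum h A₁ b * (characterSum h A₂ c * (characterSum h A₃ d *
        G a b c d))) := by
  simp only [← Finset.mul_sum]
  have hz : ∀ (A : Finset (Fin 20)) (f : ℕ → ℤ), (∀ d, f d = 0) →
      ∑ d ∈ Finset.range 5, characterSum h A d * f d = 0 := fun A f hf =>
    Finset.sum_eq_zero fun d _ => by rw [hf, mul_zero]
  refine Eq.trans ?_ (sum_powerset_character h A₀ (fun a => ∑ b ∈ Finset.range 5,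
    characterSum h A₁ b * ∑ c ∈ Finset.range 5, characterSum h A₂ c *
      ∑ d ∈ Finset.range 5, characterSum h A₃ d * G a b c d)
    fun a ha => hz _ _ fun b => hz _ _ fun c => hz _ _ fun d => hG _ _ _ _ (Or.inl ha))
  refine Finset.sum_congr rfl fun s₀ _ => congrArg _ ?_
  refine Eq.trans ?_ (sum_powerset_character h A₁ (fun b => ∑ c ∈ Finset.range 5,
    characterSum h A₂ c * ∑ d ∈ Finset.range 5, characterSum h A₃ d * G s₀.card b c d)
    fun b hb => hz _ _ fun c => hz _ _ fun d => hG _ _ _ _ (Or.inr (Or.inl hb)))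
  refine Finset.sum_congr rfl fun s₁ _ => congrArg _ ?_
  refine Eq.trans ?_ (sum_powerset_character h A₂ (fun c => ∑ d ∈ Finset.range 5,
    characterSum h A₃ d * G s₀.card s₁.card c d)
    fun c hc => hz _ _ fun d => hG _ _ _ _ (Or.inr (Or.inr (Or.inl hc))))
  refine Finset.sum_congr rfl fun s₂ _ => congrArg _ ?_
  exact sum_powerset_character h A₃ (G s₀.card s₁.card s₂.card)
    fun d hd => hG _ _ _ _ (Or.inr (Or.inr (Or.inr hd)))

/-- The coordinates on which `f` and `g` take the values `u` and `v`. -/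
def atom (f g : Fin 20 → Bool) (u v : Bool) : Finset (Fin 20) :=
  Finset.univ.filter fun i => f i = u ∧ g i = v

theorem sum_finset_eq_sum_atoms (f g h : Fin 20 → Bool) (G : ℕ → ℕ → ℕ → ℕ → ℤ) :
    ∑ s : Finset (Fin 20), character s h * G (jointCount s f g false false)
      (jointCount s f g false true) (jointCount s f g true false) (jointCount s f g true true) =
    ∑ s₀ ∈ (atom f g false false).powerset, ∑ s₁ ∈ (atom f g false true).powerset,
      ∑ s₂ ∈ (atom f g true false).powerset, ∑ s₃ ∈ (atom f g true true).powerset,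
      character s₀ h * (character s₁ h * (character s₂ h * (character s₃ h *
        G s₀.card s₁.card s₂.card s₃.card))) := by
  have hd : ∀ u v u' v', (u, v) ≠ (u', v') → Disjoint (atom f g u v) (atom f g u' v') := by
    intro u v u' v' hne
    refine Finset.disjoint_filter.2 fun i _ h₁ h₂ => hne ?_
    rw [← h₁.1, ← h₁.2, ← h₂.1, ← h₂.2]
  have hu : (Finset.univ : Finset (Finset (Fin 20))) = (atom f g false false ∪
      (atom f g false true ∪ (atom f g true false ∪ atom f g true true))).powerset := by
    rw [← Finset.powerset_univ]
    congr 1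
    ext i
    simp only [atom, Finset.mem_union, Finset.mem_filter, Finset.mem_univ, true_and, true_iff]
    cases f i <;> cases g i <;> simp
  have d₂ := hd true false true true (by decide)
  have d₁ : Disjoint (atom f g false true) (atom f g true false ∪ atom f g true true) :=
    Finset.disjoint_union_right.2 ⟨hd _ _ _ _ (by decide), hd _ _ _ _ (by decide)⟩
  have d₀ : Disjoint (atom f g false false)
      (atom f g false true ∪ (atom f g true false ∪ atom f g true true)) :=
    Finset.disjoint_union_right.2 ⟨hd _ _ _ _ (by decide),
      Finset.disjoint_union_right.2 ⟨hd _ _ _ _ (by decide), hd _ _ _ _ (by decide)⟩⟩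
  rw [hu, sum_powerset_union d₀]
  simp only [sum_powerset_union d₁, sum_powerset_union d₂]
  refine Finset.sum_congr rfl fun s₀ h₀ => Finset.sum_congr rfl fun s₁ h₁ =>
    Finset.sum_congr rfl fun s₂ h₂ => Finset.sum_congr rfl fun s₃ h₃ => ?_
  rw [Finset.mem_powerset] at h₀ h₁ h₂ h₃
  have hc : character (s₀ ∪ (s₁ ∪ (s₂ ∪ s₃))) h =
      character s₀ h * (character s₁ h * (character s₂ h * character s₃ h)) := by
    unfold character
    rw [Finset.prod_union (Finset.disjoint_of_subset_left h₀ (Finset.disjoint_of_subset_right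
        (Finset.union_subset_union h₁ (Finset.union_subset_union h₂ h₃)) d₀)),
      Finset.prod_union (Finset.disjoint_of_subset_left h₁ (Finset.disjoint_of_subset_right
        (Finset.union_subset_union h₂ h₃) d₁)),
      Finset.prod_union (Finset.disjoint_of_subset_left h₂ (Finset.disjoint_of_subset_right h₃ d₂))]
  have hj : ∀ u v u' v' (s : Finset (Fin 20)), s ⊆ atom f g u v →
      s.filter (fun i => f i = u' ∧ g i = v') = if (u, v) = (u', v') then s else ∅ := by
    intro u v u' v' s hs
    split_ifs with huv
    · cases huv
      exact Finset.filter_true_of_mem fun i hi => (Finset.mem_filter.1 (hs hi)).2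
    · refine Finset.filter_false_of_mem fun i hi h' => huv ?_
      have := (Finset.mem_filter.1 (hs hi)).2
      rw [← this.1, ← this.2, ← h'.1, ← h'.2]
  simp only [jointCount, Finset.filter_union, hj _ _ _ _ _ h₀, hj _ _ _ _ _ h₁, hj _ _ _ _ _ h₂,
    hj _ _ _ _ _ h₃, hc]
  simp [mul_assoc]

theorem trueCount_eq {α : Type*} (A : Finset α) (f g : α → Bool) :
    trueCount A f = jointCount A f g true true + jointCount A f g true false := by
  have h := jointCount_true_false A f g
  have h' : jointCount A f g true true ≤ trueCount A f :=
    Finset.card_le_card fun i hi => by simp_all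
  omega

theorem card_filter_add_compl {α : Type*} [Fintype α] [DecidableEq α] (s : Finset α) (p : α → Prop)
    [DecidablePred p] :
    (s.filter p).card + (sᶜ.filter p).card = (Finset.univ.filter p).card := by
  rw [← Finset.card_union_of_disjoint (Finset.disjoint_filter_filter disjoint_compl_right),
    ← Finset.filter_union, Finset.union_compl]

theorem weightAt_eq_splitWeight (s : Finset (Fin 20)) (f g : Fin 20 → Bool) :
    weightAt s f g = splitWeight (trueCount Finset.univ f) (trueCount Finset.univ g)
      (jointCount Finset.univ f g true true) (jointCount s f g false false,
        jointCount s f g false true, jointCount s f g true false, jointCount s f g true true) := by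
  have hs : s.card + jointCount s f g true true = _ := jointCount_false_false s f g
  have hu : Finset.univ.card + jointCount Finset.univ f g true true = _ :=
    jointCount_false_false Finset.univ f g
  rw [Finset.card_fin] at hu
  have hf : trueCount s f + trueCount sᶜ f = trueCount Finset.univ f := card_filter_add_compl s _
  have hg : trueCount s g + trueCount sᶜ g = trueCount Finset.univ g := card_filter_add_compl s _
  have hj : ∀ u v, jointCount s f g u v + jointCount sᶜ f g u v = jointCount Finset.univ f g u v :=
    fun u v => card_filter_add_compl s _
  have hsf := trueCount_eq s f g
  have hsg := trueCount_eq s g f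
  have huf := trueCount_eq Finset.univ f g
  have hug := trueCount_eq Finset.univ g f
  rw [jointCount_comm, jointCount_comm _ _ _ true false] at hsg hug
  have h₁ := hj true true
  have h₂ := hj true false
  have h₃ := hj false true
  have h₄ := hj false false
  have hguard : (Nat.ble (jointCount s f g true true) (jointCount Finset.univ f g true true) &&
      Nat.ble (jointCount s f g true false)
        (trueCount Finset.univ f - jointCount Finset.univ f g true true) &&
      Nat.ble (jointCount s f g false true)
        (trueCount Finset.univ g - jointCount Finset.univ f g true true) &&
      Nat.ble (jointCount s f g false false) (20 + jointCount Finset.univ f g true true -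
        trueCount Finset.univ f - trueCount Finset.univ g)) = true := by
    simp only [Bool.and_eq_true, Nat.ble_eq]
    omega
  rw [splitWeight]
  dsimp only
  rw [hguard, cond_true, weightAt]
  congr 1 <;> omega

theorem nth_of_length_le {α : Type} (d : α) (l : List α) (n : ℕ) (h : l.length ≤ n) :
    nth d l n = d := by
  induction l generalizing n with
  | nil => rfl
  | cons x l ih =>
    cases n with
    | zero => simp at h
    | succ n => exact ih n (by simpa using h)

theorem splitWeight_eq_zero (D D' t : ℕ) (a : ℕ × ℕ × ℕ × ℕ) (ha : a ∉ splitList) :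
    splitWeight D D' t a = 0 := by
  obtain ⟨a, b, c, d⟩ := a
  unfold splitWeight
  rw [Bool.cond_eq_ite]
  split_ifs
  swap
  · rfl
  have hmem : ∀ a b c d : Fin 5, (a : ℕ) + b + c + d < 5 → ((c : ℕ) + d) % 2 = 0 →
      ((b : ℕ) + d) % 2 = 0 → ((a : ℕ), (b : ℕ), (c : ℕ), (d : ℕ)) ∈ splitList := by
    decide +kernel
  simp only [weight]
  rcases Nat.lt_or_ge (a + b + c + d) 5 with h | h
  · rcases Nat.mod_two_eq_zero_or_one (c + d) with hp | hp
    · rcases Nat.mod_two_eq_zero_or_one (b + d) with hp' | hp'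
      · exact absurd (hmem ⟨a, by omega⟩ ⟨b, by omega⟩ ⟨c, by omega⟩ ⟨d, by omega⟩ h hp hp') ha
      · rw [blockSum_symm, blockSum_eq_zero hp']
    · rw [blockSum_eq_zero hp]
  · rw [nth_of_length_le _ certificate _ ((show certificate.length = 5 by decide +kernel) ▸ h)]
    rfl

theorem sum_range_eq_sum_splitList (F : ℕ × ℕ × ℕ × ℕ → ℤ) (hF : ∀ a ∉ splitList, F a = 0) :
    ∑ a ∈ Finset.range 5, ∑ b ∈ Finset.range 5, ∑ c ∈ Finset.range 5, ∑ d ∈ Finset.range 5,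
      F (a, b, c, d) = (splitList.map F).sum := by
  rw [← List.sum_toFinset F (by decide +kernel : splitList.Nodup)]
  have h : splitList.toFinset ⊆ Finset.range 5 ×ˢ (Finset.range 5 ×ˢ
      (Finset.range 5 ×ˢ Finset.range 5)) := by
    have h' : ∀ a ∈ splitList, a.1 < 5 ∧ a.2.1 < 5 ∧ a.2.2.1 < 5 ∧ a.2.2.2 < 5 := by decide +kernel
    intro a ha
    have := h' a (List.mem_toFinset.1 ha)
    simpa [Finset.mem_product] using this
  rw [Finset.sum_subset h fun a _ ha => hF a fun h => ha (List.mem_toFinset.2 h)]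
  simp only [Finset.sum_product]

theorem contract_map (r₀ r₁ r₂ r₃ : List ℤ) (F : ℕ × ℕ × ℕ × ℕ → ℤ) (as : List (ℕ × ℕ × ℕ × ℕ)) :
    contract r₀ r₁ r₂ r₃ as (as.map F) =
      (as.map fun a => contractTerm r₀ r₁ r₂ r₃ a (F a)).sum := by
  induction as with
  | nil => rfl
  | cons a as ih => rw [List.map_cons, contract, ih, List.map_cons, List.sum_cons]

theorem of_allBelow {f : ℕ → Bool} {n : ℕ} (h : allBelow f n = true) {k : ℕ} (hk : k < n) :
    f k = true := by
  induction n with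
  | zero => omega
  | succ n ih =>
    rw [allBelow, Bool.and_eq_true] at h
    rcases Nat.lt_succ_iff_lt_or_eq.1 hk with hk | rfl
    · exact ih h.2 hk
    · exact h.1

theorem nth_krawtchoukRow {n k a : ℕ} (hnk : n + k ≤ 20) (ha : a < 5) :
    nth 0 (krawtchoukRow n k) a = krawtchouk n k a := by
  have h := of_allBelow (of_allBelow checkKrawtchouk_eq_true (k := n) (by omega)) (k := k) (by omega)
  rw [Bool.or_eq_true, Nat.ble_eq] at h
  exact of_decide_eq_true (of_allBelow (h.resolve_left (by omega)) ha)

theorem weightRow_eq {D D' t : ℕ} (hD : D = 0 ∨ isDistance D) (hD' : D' = 0 ∨ isDistance D')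
    (hle : D ≤ D') (hD'' : D' ≤ 20) (ht : t ≤ D) (ht' : D + D' ≤ 20 + t) :
    weightRow D D' t = splitList.map (splitWeight D D' t) := by
  have hd : ∀ d, d = 0 ∨ isDistance d = true → (Nat.beq d 0 || isDistance d) = true := by
    rintro d (rfl | h)
    · rfl
    · rw [h, Bool.or_true]
  have h := of_allBelow checkWeights_eq_true (k := D) (by omega)
  rw [hd D hD, Bool.not_true, Bool.false_or] at h
  have h := of_allBelow h (k := D') (by omega)
  rw [hd D' hD', Nat.ble_eq_true_of_le hle, Bool.and_true, Bool.not_true, Bool.false_or] at h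
  have h := of_allBelow h (k := t) (by omega)
  rw [Nat.ble_eq_true_of_le ht, Nat.ble_eq_true_of_le ht', Bool.and_true, Bool.not_true,
    Bool.false_or] at h
  exact of_decide_eq_true h

/-- The distance of two words. -/
def distance (x y : Fin 20 → Bool) : ℕ := trueCount Finset.univ (differ x y)

/-- The number of coordinates in which the differences of `x` to `y`, `x'`, `y'` are `u`, `v`,
`w`. -/
def col (x y x' y' : Fin 20 → Bool) (u v w : Bool) : ℕ :=
  (Finset.univ.filter fun i => differ x y i = u ∧ differ x x' i = v ∧ differ x y' i = w).card

theorem card_eq_sum_col (x y x' y' : Fin 20 → Bool) (φ : Bool → Bool → Bool → Bool) :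
    (Finset.univ.filter fun i => φ (differ x y i) (differ x x' i) (differ x y' i) = true).card =
      ∑ u, ∑ v, ∑ w, bif φ u v w then col x y x' y' u v w else 0 := by
  rw [Finset.card_eq_sum_card_fiberwise (t := Finset.univ)
    (f := fun i => (differ x y i, differ x x' i, differ x y' i)) (fun _ _ => Finset.mem_coe.2 (Finset.mem_univ _)),
    Fintype.sum_prod_type]
  refine Finset.sum_congr rfl fun u _ => ?_
  rw [Fintype.sum_prod_type]
  refine Finset.sum_congr rfl fun v _ => Finset.sum_congr rfl fun w _ => ?_
  rw [Finset.filter_filter, col]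
  cases hφ : φ u v w
  · rw [cond_false, Finset.card_eq_zero, Finset.filter_eq_empty_iff]
    rintro i - ⟨h, h'⟩
    simp only [Prod.mk.injEq] at h'
    rw [h'.1, h'.2.1, h'.2.2, hφ] at h
    exact absurd h (by decide)
  · rw [cond_true]
    congr 1
    refine Finset.filter_congr fun i _ => ?_
    simp only [Prod.mk.injEq]
    refine ⟨fun h => h.2, fun h => ⟨?_, h⟩⟩
    rw [h.1, h.2.1, h.2.2, hφ]

theorem sum_col (x y x' y' : Fin 20 → Bool) :
    col x y x' y' true true true + col x y x' y' true true false + col x y x' y' true false true +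
      col x y x' y' true false false + col x y x' y' false true true +
      col x y x' y' false true false + col x y x' y' false false true +
      col x y x' y' false false false = 20 := by
  have h := card_eq_sum_col x y x' y' fun _ _ _ => true
  simp only [Finset.filter_true, Finset.card_fin, Fintype.sum_bool, cond_true] at h
  omega

theorem distance_eq_col (x y x' y' : Fin 20 → Bool) :
    distance x y = col x y x' y' true true true + col x y x' y' true true false +
      col x y x' y' true false true + col x y x' y' true false false := by
  have h := card_eq_sum_col x y x' y' fun u _ _ => u
  simp only [Fintype.sum_bool, cond_true, cond_false, add_zero] at h
  exact h.trans (by ring)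

theorem atom_eq (x y x' y' : Fin 20 → Bool) (u v : Bool) :
    atom (differ x y) (differ x' y') u v =
      (Finset.univ.filter fun i => differ x y i = u ∧ differ x x' i = false ∧ differ x y' i = v) ∪
      (Finset.univ.filter fun i =>
        differ x y i = u ∧ differ x x' i = true ∧ differ x y' i = (!v)) := by
  have h : ∀ i, differ x' y' i = xor (differ x x' i) (differ x y' i) := by
    intro i
    simp only [differ]
    cases x i <;> cases x' i <;> cases y' i <;> rfl
  rw [← Finset.filter_or]
  refine Finset.filter_congr fun i _ => ?_
  rw [h]
  cases differ x x' i <;> cases differ x y' i <;> cases v <;> simp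

theorem characterSum_atom (x y x' y' : Fin 20 → Bool) (u v : Bool) (a : ℕ) :
    characterSum (differ x x') (atom (differ x y) (differ x' y') u v) a =
      krawtchouk (col x y x' y' u false v) (col x y x' y' u true (!v)) a := by
  rw [atom_eq, characterSum_eq _ _ _ (fun i hi => (Finset.mem_filter.1 hi).2.2.1)
    (fun i hi => (Finset.mem_filter.1 hi).2.2.1)]
  rfl

theorem jointCount_eq_col (x y x' y' : Fin 20 → Bool) (u v : Bool) :
    jointCount Finset.univ (differ x y) (differ x' y') u v =
      col x y x' y' u false v + col x y x' y' u true (!v) := by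
  refine (congrArg Finset.card (atom_eq x y x' y' u v)).trans (Finset.card_union_of_disjoint ?_)
  refine Finset.disjoint_filter.2 fun i _ h₁ h₂ => ?_
  simp_all

theorem mem_splitList_lt {a : ℕ × ℕ × ℕ × ℕ} (ha : a ∈ splitList) :
    a.1 < 5 ∧ a.2.1 < 5 ∧ a.2.2.1 < 5 ∧ a.2.2.2 < 5 := by
  have h : ∀ a ∈ splitList, a.1 < 5 ∧ a.2.1 < 5 ∧ a.2.2.1 < 5 ∧ a.2.2.2 < 5 := by decide +kernel
  exact h a ha

theorem kernel_eq_contract (x y x' y' : Fin 20 → Bool)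
    (hD : distance x y = 0 ∨ isDistance (distance x y))
    (hD' : distance x' y' = 0 ∨ isDistance (distance x' y'))
    (hle : distance x y ≤ distance x' y') :
    kernel x y x' y' =
      contract (krawtchoukRow (col x y x' y' false false false) (col x y x' y' false true true))
        (krawtchoukRow (col x y x' y' false false true) (col x y x' y' false true false))
        (krawtchoukRow (col x y x' y' true false false) (col x y x' y' true true true))
        (krawtchoukRow (col x y x' y' true false true) (col x y x' y' true true false)) splitList
        (weightRow (distance x y) (distance x' y')
          (col x y x' y' true false true + col x y x' y' true true false)) := by
  have ht : jointCount Finset.univ (differ x y) (differ x' y') true true =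
      col x y x' y' true false true + col x y x' y' true true false := jointCount_eq_col ..
  have h₁ : distance x y = _ := trueCount_eq Finset.univ (differ x y) (differ x' y')
  have h₂ : distance x' y' = _ := trueCount_eq Finset.univ (differ x' y') (differ x y)
  have h₃ := jointCount_false_false Finset.univ (differ x y) (differ x' y')
  rw [Finset.card_fin] at h₃
  have h₄ : distance x' y' ≤ 20 := (Finset.card_filter_le _ _).trans_eq (Finset.card_fin 20)
  change _ = _ + distance x y + distance x' y' at h₃
  have hs := sum_col x y x' y'
  rw [weightRow_eq hD hD' hle h₄ (by omega) (by omega), contract_map,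
    ← sum_range_eq_sum_splitList]
  · have hz : ∀ a b c d, 5 ≤ a ∨ 5 ≤ b ∨ 5 ≤ c ∨ 5 ≤ d →
        splitWeight (distance x y) (distance x' y')
          (jointCount Finset.univ (differ x y) (differ x' y') true true) (a, b, c, d) = 0 := by
      intro a b c d h
      refine splitWeight_eq_zero _ _ _ _ fun hmem => ?_
      have := mem_splitList_lt hmem
      dsimp only at this
      omega
    have hk : kernel x y x' y' = ∑ s : Finset (Fin 20), character s (differ x x') *
        splitWeight (distance x y) (distance x' y')
          (jointCount Finset.univ (differ x y) (differ x' y') true true)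
          (jointCount s (differ x y) (differ x' y') false false,
            jointCount s (differ x y) (differ x' y') false true,
            jointCount s (differ x y) (differ x' y') true false,
            jointCount s (differ x y) (differ x' y') true true) :=
      Finset.sum_congr rfl fun s _ => by
        rw [character_mul, weightAt_eq_splitWeight, distance, distance]
    rw [hk, ← ht, sum_finset_eq_sum_atoms _ _ _ fun a b c d => splitWeight (distance x y)
      (distance x' y') (jointCount Finset.univ (differ x y) (differ x' y') true true) (a, b, c, d),
      sum_powerset_character_four _ _ _ _ _ _ hz]
    simp only [characterSum_atom, contractTerm]
    refine Finset.sum_congr rfl fun a ha => Finset.sum_congr rfl fun b hb =>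
      Finset.sum_congr rfl fun c hc => Finset.sum_congr rfl fun d hd => ?_
    rw [Finset.mem_range] at ha hb hc hd
    rw [nth_krawtchoukRow (by omega) ha, nth_krawtchoukRow (by omega) hb,
      nth_krawtchoukRow (by omega) hc, nth_krawtchoukRow (by omega) hd]
    simp only [Bool.not_false, Bool.not_true]
    ring
  · intro a ha
    rw [contractTerm, splitWeight_eq_zero _ _ _ _ ha, zero_mul]

theorem col_exchange (x y x' y' : Fin 20 → Bool) (u v w : Bool) :
    col x' y' x y u v w = col x y x' y' (xor v w) v (xor v u) := by
  unfold col
  congr 1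
  refine Finset.filter_congr fun i _ => ?_
  simp only [differ]
  cases x i <;> cases y i <;> cases x' i <;> cases y' i <;> cases u <;> cases v <;> cases w <;> simp

theorem kernel_eq_typeKernel (x y x' y' : Fin 20 → Bool)
    (hD : distance x y = 0 ∨ isDistance (distance x y))
    (hD' : distance x' y' = 0 ∨ isDistance (distance x' y')) :
    kernel x y x' y' = typeKernel (col x y x' y' false false false) (col x y x' y' true true true)
      (col x y x' y' true false false) (col x y x' y' false true false)
      (col x y x' y' false false true) (col x y x' y' false true true)
      (col x y x' y' true false true) (col x y x' y' true true false) := by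
  have h₁ := distance_eq_col x y x' y'
  have h₂ := distance_eq_col x' y' x y
  simp only [col_exchange x y x' y', Bool.xor_false, Bool.xor_true, Bool.not_false,
    Bool.not_true] at h₂
  have h₁' : distance x y = col x y x' y' true true true + col x y x' y' true false false +
    col x y x' y' true false true + col x y x' y' true true false := by omega
  have h₂' : distance x' y' = col x y x' y' false true false + col x y x' y' false false true +
    col x y x' y' true false true + col x y x' y' true true false := by omega
  rw [typeKernel, Bool.cond_eq_ite]
  split_ifs with h <;> rw [Nat.ble_eq] at h
  · rw [← h₁', ← h₂', kernel_eq_contract x y x' y' hD hD' (by omega)]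
  · rw [← h₁', ← h₂', kernel_exchange, kernel_eq_contract x' y' x y hD' hD (by omega)]
    simp only [col_exchange x y x' y', Bool.xor_false, Bool.xor_true, Bool.not_false,
      Bool.not_true]

theorem of_isNeg_eq_false {z : ℤ} (h : isNeg z = false) : 0 ≤ z := by
  cases z with
  | ofNat n => exact Int.natCast_nonneg n
  | negSucc n => cases h

theorem of_isNeg_eq_true {z : ℤ} (h : isNeg z = true) : z < 0 := by
  cases z with
  | ofNat n => cases h
  | negSucc n => exact Int.negSucc_lt_zero n

theorem distance_self (x : Fin 20 → Bool) : distance x x = 0 := by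
  rw [distance, trueCount, Finset.card_eq_zero, Finset.filter_eq_empty_iff]
  intro i _
  simp [differ]

theorem distance_comm (x y : Fin 20 → Bool) : distance x y = distance y x := by
  rw [distance, distance, differ_comm]

/-- The number of coordinates in which the difference of `a` and `b` is `u`. -/
def differCount (a b : Fin 20 → Bool) (u : Bool) : ℕ :=
  (Finset.univ.filter fun i => differ a b i = u).card

theorem differCount_true (a b : Fin 20 → Bool) : differCount a b true = distance a b := rfl

theorem differCount_false (a b : Fin 20 → Bool) : differCount a b false = 20 - distance a b := by
  have h := Finset.card_filter_add_card_filter_not (s := Finset.univ) (fun i => differ a b i = true)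
  simp only [Bool.not_eq_true, Finset.card_fin] at h
  unfold differCount distance trueCount
  omega

theorem kernel_self (a : Fin 20 → Bool) : kernel a a a a = typeKernel 20 0 0 0 0 0 0 0 := by
  have h : ∀ u v w, col a a a a u v w = bif u || v || w then 0 else 20 := by
    intro u v w
    unfold col
    cases u <;> cases v <;> cases w <;> simp [differ]
  rw [kernel_eq_typeKernel _ _ _ _ (Or.inl (distance_self a)) (Or.inl (distance_self a))]
  simp only [h]
  rfl

/-- The contribution of the quadruples formed by two different words. -/
def pairKernel (a b : Fin 20 → Bool) : ℤ :=
  kernel a a b b + kernel a b a b + kernel a b b a + kernel a a a b + kernel a a b a +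
    kernel a b a a + kernel a b b b

theorem pairKernel_eq {a b : Fin 20 → Bool} (hd : isDistance (distance a b)) :
    pairKernel a b = pairEntry (distance a b) := by
  have hle : distance a b < 21 :=
    Nat.lt_succ_of_le ((Finset.card_filter_le _ _).trans_eq (Finset.card_fin 20))
  have hab : distance a b = 0 ∨ isDistance (distance a b) := Or.inr hd
  have hba : distance b a = 0 ∨ isDistance (distance b a) := distance_comm a b ▸ hab
  have haa : distance a a = 0 ∨ isDistance (distance a a) := Or.inl (distance_self a)
  have hbb : distance b b = 0 ∨ isDistance (distance b b) := Or.inl (distance_self b)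
  have h₁ : ∀ u v w, col a a b b u v w = bif !u && (v == w) then differCount a b v else 0 := by
    intro u v w
    unfold col differCount
    cases u <;> cases v <;> cases w <;> simp [differ]
  have h₂ : ∀ u v w, col a b a b u v w = bif !v && (u == w) then differCount a b u else 0 := by
    intro u v w
    unfold col differCount
    cases u <;> cases v <;> cases w <;> simp [differ]
  have h₃ : ∀ u v w, col a b b a u v w = bif !w && (u == v) then differCount a b u else 0 := by
    intro u v w
    unfold col differCount
    cases u <;> cases v <;> cases w <;> simp [differ]
  have h₄ : ∀ u v w, col a a a b u v w = bif u || v then 0 else differCount a b w := by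
    intro u v w
    unfold col differCount
    cases u <;> cases v <;> cases w <;> simp [differ]
  have h₅ : ∀ u v w, col a a b a u v w = bif u || w then 0 else differCount a b v := by
    intro u v w
    unfold col differCount
    cases u <;> cases v <;> cases w <;> simp [differ]
  have h₆ : ∀ u v w, col a b a a u v w = bif v || w then 0 else differCount a b u := by
    intro u v w
    unfold col differCount
    cases u <;> cases v <;> cases w <;> simp [differ]
  have h₇ : ∀ u v w, col a b b b u v w = bif u == v && (u == w) then differCount a b u else 0 := by
    intro u v w
    unfold col differCount
    cases u <;> cases v <;> cases w <;> simp [differ]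
  have h := of_allBelow checkPairs_eq_true hle
  rw [hd, Bool.not_true, Bool.false_or] at h
  rw [of_decide_eq_true h, pairKernel, pairValue, kernel_eq_typeKernel a a b b haa hbb,
    kernel_eq_typeKernel a b a b hab hab, kernel_eq_typeKernel a b b a hab hba,
    kernel_eq_typeKernel a a a b haa hab, kernel_eq_typeKernel a a b a haa hba,
    kernel_eq_typeKernel a b a a hab haa, kernel_eq_typeKernel a b b b hab hbb]
  simp only [h₁, h₂, h₃, h₄, h₅, h₆, h₇, differCount_true, differCount_false]
  rfl

/-- The contribution of the quadruples formed by three different words. -/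
def tripleKernel (a b c : Fin 20 → Bool) : ℤ :=
  kernel a a b c + kernel a b a c + kernel a b b c + kernel a b c a + kernel a b c b + kernel a b c c

/-- The number of coordinates in which the differences of `a` to `b` and `c` are `u` and `v`. -/
def tripleCol (a b c : Fin 20 → Bool) (u v : Bool) : ℕ :=
  jointCount Finset.univ (differ a b) (differ a c) u v

theorem repeated_kernel_eq {a b c : Fin 20 → Bool} (hab : isDistance (distance a b))
    (hac : isDistance (distance a c)) (hbc : isDistance (distance b c)) :
    4 * kernel a a b c + 8 * kernel a b a c =
      tripleValue (tripleCol a b c true false) (tripleCol a b c false true)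
        (tripleCol a b c true true) := by
  have h₁ : ∀ u v w, col a a b c u v w = bif u then 0 else tripleCol a b c v w := by
    intro u v w
    unfold col tripleCol jointCount
    cases u <;> cases v <;> cases w <;> simp [differ]
  have h₂ : ∀ u v w, col a b a c u v w = bif v then 0 else tripleCol a b c u w := by
    intro u v w
    unfold col tripleCol jointCount
    cases u <;> cases v <;> cases w <;> simp [differ]
  have hs := sum_col a a b c
  simp only [h₁, cond_true, cond_false, zero_add] at hs
  have hs' : 20 - tripleCol a b c true false - tripleCol a b c false true -
    tripleCol a b c true true = tripleCol a b c false false := by omega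
  rw [tripleValue, hs', kernel_eq_typeKernel a a b c (Or.inl (distance_self a)) (Or.inr hbc),
    kernel_eq_typeKernel a b a c (Or.inr hab) (Or.inr hac)]
  simp only [h₁, h₂]
  rfl

/-- The sum of `f` over all orders of three words. -/
def orderSum (f : (Fin 20 → Bool) → (Fin 20 → Bool) → (Fin 20 → Bool) → ℤ)
    (a b c : Fin 20 → Bool) : ℤ :=
  f a b c + f a c b + f b a c + f b c a + f c a b + f c b a

/-- The combined contribution of degenerate quadruples. -/
def degenerateKernel (a b c : Fin 20 → Bool) : ℤ :=
  256 * 255 * tripleKernel a b c + 256 * pairKernel a b + kernel a a a a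

theorem orderSum_tripleKernel (a b c : Fin 20 → Bool) :
    orderSum tripleKernel a b c = 4 * kernel a a b c + 8 * kernel a b a c +
      (4 * kernel b b a c + 8 * kernel b a b c) + (4 * kernel c c a b + 8 * kernel c a c b) := by
  have h₁ : ∀ a b c, kernel b c a a = kernel a a b c := fun a b c => kernel_exchange ..
  have h₂ : ∀ a b c, kernel a a c b = kernel a a b c := fun a b c => kernel_swap_right ..
  have h₃ : ∀ a b c, kernel b a a c = kernel a b a c := fun a b c => kernel_swap_left ..
  have h₄ : ∀ a b c, kernel a b c a = kernel a b a c := fun a b c => kernel_swap_right ..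
  have h₅ : ∀ a b c, kernel b a c a = kernel a b a c := fun a b c => by
    rw [kernel_swap_left, kernel_swap_right]
  have h₆ : ∀ a b c, kernel a c a b = kernel a b a c := fun a b c => kernel_exchange ..
  unfold orderSum tripleKernel
  linarith [h₁ a b c, h₁ b a c, h₁ c a b, h₂ a b c, h₂ b a c, h₂ c a b, h₁ a c b, h₁ b c a,
    h₁ c b a, h₃ a b c, h₃ b a c, h₃ c a b, h₃ a c b, h₃ b c a, h₃ c b a, h₄ a b c, h₄ b a c,
    h₄ c a b, h₄ a c b, h₄ b c a, h₄ c b a, h₅ a b c, h₅ b a c, h₅ c a b, h₅ a c b, h₅ b c a,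
    h₅ c b a, h₆ a b c, h₆ b a c, h₆ c a b]

theorem orderSum_degenerateKernel_le {a b c : Fin 20 → Bool} (hab : isDistance (distance a b))
    (hac : isDistance (distance a c)) (hbc : isDistance (distance b c)) :
    orderSum degenerateKernel a b c ≤
      tripleBound (distance a b) (distance a c) (distance b c) := by
  have hb : ∀ u v, tripleCol b a c u v = tripleCol a b c u (xor u v) := by
    intro u v
    unfold tripleCol jointCount
    congr 1
    refine Finset.filter_congr fun i _ => ?_
    simp only [differ]
    cases a i <;> cases b i <;> cases c i <;> cases u <;> cases v <;> simp
  have hc : ∀ u v, tripleCol c a b u v = tripleCol a b c (xor u v) u := by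
    intro u v
    unfold tripleCol jointCount
    congr 1
    refine Finset.filter_congr fun i _ => ?_
    simp only [differ]
    cases a i <;> cases b i <;> cases c i <;> cases u <;> cases v <;> simp
  have h₁ : distance a b = tripleCol a b c true true + tripleCol a b c true false :=
    trueCount_eq ..
  have h₂ : distance a c = tripleCol a b c true true + tripleCol a b c false true := by
    refine (trueCount_eq _ _ (differ a b)).trans ?_
    rw [jointCount_comm, jointCount_comm _ _ _ true false]
    rfl
  have h₃ : distance b c = tripleCol a b c true false + tripleCol a b c false true := by
    have h := trueCount_eq Finset.univ (differ b c) (differ b a)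
    rw [jointCount_comm, jointCount_comm _ _ _ true false] at h
    exact h.trans (congrArg₂ _ (hb true true) (hb false true))
  have h₄ : tripleCol a b c true true + tripleCol a b c true false +
      tripleCol a b c false true ≤ 20 := by
    have h := jointCount_false_false Finset.univ (differ a b) (differ a c)
    rw [Finset.card_fin] at h
    change 20 + tripleCol a b c true true = _ + distance a b + distance a c at h
    omega
  have hd : orderSum degenerateKernel a b c = degenerateValue (tripleCol a b c true true)
      (tripleCol a b c true false) (tripleCol a b c false true) := by
    have h : orderSum degenerateKernel a b c = 256 * 255 * orderSum tripleKernel a b c +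
        256 * (pairKernel a b + pairKernel b a + pairKernel a c + pairKernel c a +
          pairKernel b c + pairKernel c b) + 2 * kernel a a a a + 2 * kernel b b b b +
        2 * kernel c c c c := by
      unfold orderSum degenerateKernel
      ring
    have hba := distance_comm a b ▸ hab
    have hca := distance_comm a c ▸ hac
    have hcb := distance_comm b c ▸ hbc
    rw [h, orderSum_tripleKernel, repeated_kernel_eq hab hac hbc, repeated_kernel_eq hba hbc hac,
      repeated_kernel_eq hca hcb hab, pairKernel_eq hab, pairKernel_eq hac, pairKernel_eq hbc,
      pairKernel_eq hba, pairKernel_eq hca, pairKernel_eq hcb, kernel_self, kernel_self,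
      kernel_self, distance_comm b a, distance_comm c a, distance_comm c b, h₁, h₂, h₃,
      degenerateValue]
    simp only [hb, hc, Bool.xor_false, Bool.xor_true, Bool.not_false, Bool.not_true]
    ring
  rw [hd]
  rw [h₁] at hab
  rw [h₂] at hac
  rw [h₃] at hbc
  rw [h₁, h₂, h₃]
  have h := of_allBelow checkTriples_eq_true (k := tripleCol a b c true true) (by omega)
  have h := of_allBelow h (k := tripleCol a b c true false) (by omega)
  rw [hab, Bool.not_true, Bool.false_or] at h
  have h := of_allBelow h (k := tripleCol a b c false true) (by omega)
  rw [hac, hbc, Nat.ble_eq_true_of_le h₄, Bool.and_true, Bool.and_true, Bool.not_true,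
    Bool.false_or, Bool.not_eq_true'] at h
  exact sub_nonneg.1 (of_isNeg_eq_false h)

theorem sum_perm_four (f : Fin 4 → Fin 4 → Fin 4 → Fin 4 → ℤ) :
    ∑ σ : Equiv.Perm (Fin 4), f (σ 0) (σ 1) (σ 2) (σ 3) =
      f 0 1 2 3 + f 0 1 3 2 + f 0 2 1 3 + f 0 2 3 1 + f 0 3 1 2 + f 0 3 2 1 + f 1 0 2 3 + f 1 0 3
      2 + f 1 2 0 3 + f 1 2 3 0 + f 1 3 0 2 + f 1 3 2 0 + f 2 0 1 3 + f 2 0 3 1 + f 2 1 0 3 + f 2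
      1 3 0 + f 2 3 0 1 + f 2 3 1 0 + f 3 0 1 2 + f 3 0 2 1 + f 3 1 0 2 + f 3 1 2 0 + f 3 2 0 1 +
      f 3 2 1 0 := by
  have h : (Finset.univ : Finset (Equiv.Perm (Fin 4))).val.map (fun σ => (σ 0, σ 1, σ 2, σ 3)) =
      Multiset.ofList [(0, 1, 2, 3), (0, 1, 3, 2), (0, 2, 1, 3), (0, 2, 3, 1), (0, 3, 1, 2), (0, 3, 2, 1), (1, 0,
      2, 3), (1, 0, 3, 2), (1, 2, 0, 3), (1, 2, 3, 0), (1, 3, 0, 2), (1, 3, 2, 0), (2, 0, 1, 3),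
      (2, 0, 3, 1), (2, 1, 0, 3), (2, 1, 3, 0), (2, 3, 0, 1), (2, 3, 1, 0), (3, 0, 1, 2), (3, 0,
      2, 1), (3, 1, 0, 2), (3, 1, 2, 0), (3, 2, 0, 1), (3, 2, 1, 0)] := by
    decide +kernel
  have h' := congrArg (fun m => (m.map fun p : Fin 4 × Fin 4 × Fin 4 × Fin 4 =>
    f p.1 p.2.1 p.2.2.1 p.2.2.2).sum) h
  simp only [Multiset.map_map, Multiset.map_coe, Multiset.sum_coe, List.map_cons, List.map_nil,
    List.sum_cons, List.sum_nil] at h'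
  refine Eq.trans h' ?_
  ring

/-- The contribution of a quadruple of different words. -/
def quadKernel (x y z w : Fin 20 → Bool) : ℤ :=
  256 * 255 * 254 * kernel x y z w + degenerateKernel x y z

/-- The sum of `quadKernel` over all orders of four words. -/
def quadSum (z : Fin 4 → Fin 20 → Bool) : ℤ :=
  ∑ σ : Equiv.Perm (Fin 4), quadKernel (z (σ 0)) (z (σ 1)) (z (σ 2)) (z (σ 3))

theorem quadSum_comp (z : Fin 4 → Fin 20 → Bool) (τ : Equiv.Perm (Fin 4)) :
    quadSum (z ∘ τ) = quadSum z :=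
  Equiv.sum_comp (Equiv.mulLeft τ)
    fun σ => quadKernel (z (σ 0)) (z (σ 1)) (z (σ 2)) (z (σ 3))

theorem sum_kernel_symm (x y z w : Fin 20 → Bool) :
    kernel x y z w + kernel y x z w + kernel x y w z + kernel y x w z + kernel z w x y +
      kernel w z x y + kernel z w y x + kernel w z y x = 8 * kernel x y z w := by
  rw [kernel_exchange w z y x, kernel_exchange z w y x, kernel_exchange w z x y,
    kernel_exchange z w x y, kernel_swap_right y x w z, kernel_swap_right x y w z,
    kernel_swap_left y x z w]
  ring

theorem quadSum_eq (z : Fin 4 → Fin 20 → Bool) :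
    quadSum z = 8 * (256 * 255 * 254) * (kernel (z 0) (z 1) (z 2) (z 3) +
      kernel (z 0) (z 2) (z 1) (z 3) + kernel (z 0) (z 3) (z 2) (z 1)) +
      (orderSum degenerateKernel (z 0) (z 1) (z 2) + orderSum degenerateKernel (z 0) (z 1) (z 3) +
      orderSum degenerateKernel (z 0) (z 2) (z 3) + orderSum degenerateKernel (z 1) (z 2) (z 3)) := by
  rw [quadSum, sum_perm_four fun i j k l => quadKernel (z i) (z j) (z k) (z l)]
  unfold quadKernel orderSum
  linarith [sum_kernel_symm (z 0) (z 1) (z 2) (z 3), sum_kernel_symm (z 0) (z 2) (z 1) (z 3),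
    sum_kernel_symm (z 0) (z 3) (z 2) (z 1)]

theorem distance_eq_sum_col (x y x' y' a b : Fin 20 → Bool) (φ : Bool → Bool → Bool → Bool)
    (h : ∀ i, differ a b i = φ (differ x y i) (differ x x' i) (differ x y' i)) :
    distance a b = ∑ u, ∑ v, ∑ w, bif φ u v w then col x y x' y' u v w else 0 := by
  rw [← card_eq_sum_col, distance, trueCount]
  simp only [h]

theorem quadSum_neg_of_monotone (z : Fin 4 → Fin 20 → Bool)
    (hz : ∀ i j, i ≠ j → isDistance (distance (z i) (z j)) = true)
    (hm : Monotone fun i => ∑ j, distance (z i) (z j)) : quadSum z < 0 := by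
  have h₁ := kernel_eq_typeKernel (z 0) (z 1) (z 2) (z 3) (Or.inr (hz _ _ (by decide)))
    (Or.inr (hz _ _ (by decide)))
  have h₂ := kernel_eq_typeKernel (z 0) (z 2) (z 1) (z 3) (Or.inr (hz _ _ (by decide)))
    (Or.inr (hz _ _ (by decide)))
  have h₃ := kernel_eq_typeKernel (z 0) (z 3) (z 2) (z 1) (Or.inr (hz _ _ (by decide)))
    (Or.inr (hz _ _ (by decide)))
  have c₂ : ∀ u v w, col (z 0) (z 2) (z 1) (z 3) u v w = col (z 0) (z 1) (z 2) (z 3) v u w := by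
    intro u v w
    simp only [col, and_left_comm]
  have c₃ : ∀ u v w, col (z 0) (z 3) (z 2) (z 1) u v w = col (z 0) (z 1) (z 2) (z 3) w v u := by
    intro u v w
    exact congrArg Finset.card (Finset.filter_congr fun i _ =>
      ⟨fun h => ⟨h.2.2, h.2.1, h.1⟩, fun h => ⟨h.2.2, h.2.1, h.1⟩⟩)
  have hb := quadSum_eq z
  rw [h₁, h₂, h₃] at hb
  simp only [c₂, c₃] at hb
  have t₁ := orderSum_degenerateKernel_le (hz 0 1 (by decide)) (hz 0 2 (by decide))
    (hz 1 2 (by decide))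
  have t₂ := orderSum_degenerateKernel_le (hz 0 1 (by decide)) (hz 0 3 (by decide))
    (hz 1 3 (by decide))
  have t₃ := orderSum_degenerateKernel_le (hz 0 2 (by decide)) (hz 0 3 (by decide))
    (hz 2 3 (by decide))
  have t₄ := orderSum_degenerateKernel_le (hz 1 2 (by decide)) (hz 1 3 (by decide))
    (hz 2 3 (by decide))
  have d₁ := distance_eq_sum_col (z 0) (z 1) (z 2) (z 3) (z 0) (z 1) (fun u _ _ => u)
    fun i => rfl
  have d₂ := distance_eq_sum_col (z 0) (z 1) (z 2) (z 3) (z 0) (z 2) (fun _ v _ => v)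
    fun i => rfl
  have d₃ := distance_eq_sum_col (z 0) (z 1) (z 2) (z 3) (z 0) (z 3) (fun _ _ w => w)
    fun i => rfl
  have hx : ∀ a b c : Bool, xor b c = xor (xor a b) (xor a c) := by decide
  have d₄ := distance_eq_sum_col (z 0) (z 1) (z 2) (z 3) (z 1) (z 2) (fun u v _ => xor u v)
    fun i => hx ..
  have d₅ := distance_eq_sum_col (z 0) (z 1) (z 2) (z 3) (z 1) (z 3) (fun u _ w => xor u w)
    fun i => hx ..
  have d₆ := distance_eq_sum_col (z 0) (z 1) (z 2) (z 3) (z 2) (z 3) (fun _ v w => xor v w)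
    fun i => hx ..
  simp only [Fintype.sum_bool, cond_true, cond_false, Bool.xor_false, Bool.xor_true, Bool.not_true,
    Bool.not_false] at d₁ d₂ d₃ d₄ d₅ d₆
  have hs := sum_col (z 0) (z 1) (z 2) (z 3)
  have m₁ := hm (show (0 : Fin 4) ≤ 1 by decide)
  have m₂ := hm (show (1 : Fin 4) ≤ 2 by decide)
  have m₃ := hm (show (2 : Fin 4) ≤ 3 by decide)
  simp only [Fin.sum_univ_four, distance_self, distance_comm (z 1) (z 0), distance_comm (z 2) (z 0),
    distance_comm (z 2) (z 1), distance_comm (z 3) (z 0), distance_comm (z 3) (z 1),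
    distance_comm (z 3) (z 2)] at m₁ m₂ m₃
  have e₁ := hz 0 1 (by decide)
  have e₂ := hz 0 2 (by decide)
  have e₃ := hz 0 3 (by decide)
  have e₄ := hz 1 2 (by decide)
  have e₅ := hz 1 3 (by decide)
  have e₆ := hz 2 3 (by decide)
  generalize col (z 0) (z 1) (z 2) (z 3) false false false = n₀ at *
  generalize col (z 0) (z 1) (z 2) (z 3) true true true = p₁ at *
  generalize col (z 0) (z 1) (z 2) (z 3) true false false = p₂ at *
  generalize col (z 0) (z 1) (z 2) (z 3) false true false = p₃ at *
  generalize col (z 0) (z 1) (z 2) (z 3) false false true = p₄ at *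
  generalize col (z 0) (z 1) (z 2) (z 3) false true true = q₂ at *
  generalize col (z 0) (z 1) (z 2) (z 3) true false true = q₃ at *
  generalize col (z 0) (z 1) (z 2) (z 3) true true false = q₄ at *
  have d₁' : distance (z 0) (z 1) = p₁ + p₂ + q₃ + q₄ := by omega
  have d₂' : distance (z 0) (z 2) = p₁ + p₃ + q₂ + q₄ := by omega
  have d₃' : distance (z 0) (z 3) = p₁ + p₄ + q₂ + q₃ := by omega
  have d₄' : distance (z 1) (z 2) = p₂ + p₃ + q₂ + q₃ := by omega
  have d₅' : distance (z 1) (z 3) = p₂ + p₄ + q₂ + q₄ := by omega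
  have d₆' : distance (z 2) (z 3) = p₃ + p₄ + q₃ + q₄ := by omega
  rw [d₁'] at e₁ t₁ t₂
  rw [d₂'] at e₂ t₁ t₃
  rw [d₃'] at e₃ t₂ t₃
  rw [d₄'] at e₄ t₁ t₄
  rw [d₅'] at e₅ t₂ t₄
  rw [d₆'] at e₆ t₃ t₄
  have hle : quadSum z ≤ quadBound n₀ p₁ p₂ p₃ p₄ q₂ q₃ q₄ := by
    rw [hb, quadBound]
    linarith
  refine hle.trans_lt (of_isNeg_eq_true ?_)
  have h := of_allBelow checkQuads_eq_true (k := q₂) (by omega)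
  have h := of_allBelow h (k := q₃) (by omega)
  have h := of_allBelow h (k := q₄) (by omega)
  have h := of_allBelow h (k := p₁) (by omega)
  have h := of_allBelow h (k := p₂) (by omega)
  rw [e₁, Nat.ble_eq_true_of_le (show p₁ ≤ p₂ by omega)] at h
  have h := of_allBelow h (k := p₃) (by omega)
  rw [e₂, e₄, Nat.ble_eq_true_of_le (show p₂ ≤ p₃ by omega)] at h
  have h := of_allBelow h (k := p₄) (by omega)
  rw [e₃, e₅, e₆, Nat.ble_eq_true_of_le (show p₃ ≤ p₄ by omega)] at h
  rwa [show n₀ = 20 - (p₁ + p₂ + p₃ + p₄ + q₂ + q₃ + q₄) by omega]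

theorem quadSum_neg (z : Fin 4 → Fin 20 → Bool)
    (hz : ∀ i j, i ≠ j → isDistance (distance (z i) (z j)) = true) : quadSum z < 0 := by
  have h := Tuple.monotone_sort fun i => ∑ j, distance (z i) (z j)
  rw [← quadSum_comp z (Tuple.sort fun i => ∑ j, distance (z i) (z j))]
  refine quadSum_neg_of_monotone _ (fun i j hij => hz _ _ ?_) fun i j hij => ?_
  · exact fun h => hij (Equiv.injective _ h)
  · have h' := h hij
    simp only [Function.comp_apply] at h' ⊢
    rwa [Equiv.sum_comp _ fun j => distance (z _) (z j),
      Equiv.sum_comp _ fun j => distance (z _) (z j)]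

theorem sum_eq_add_sum_erase {α : Type*} [DecidableEq α] {S : Finset α} {a : α} (ha : a ∈ S)
    (f : α → ℤ) : ∑ x ∈ S, f x = f a + ∑ x ∈ S.erase a, f x :=
  (Finset.add_sum_erase S f ha).symm

theorem sum_quadruples {α : Type*} [DecidableEq α] (S : Finset α) (F : α → α → α → α → ℤ) :
    ∑ x ∈ S, ∑ y ∈ S, ∑ z ∈ S, ∑ w ∈ S, F x y z w =
      ∑ x ∈ S, (F x x x x + ∑ y ∈ S.erase x, ((F x x y y + F x y x y + F x y y x + F x x x y +
        F x x y x + F x y x x + F x y y y) + ∑ z ∈ (S.erase x).erase y, ((F x x y z + F x y x z +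
        F x y y z + F x y z x + F x y z y + F x y z z) +
          ∑ w ∈ ((S.erase x).erase y).erase z, F x y z w))) := by
  refine Finset.sum_congr rfl fun x hx => ?_
  have h₁ : ∑ z ∈ S, ∑ w ∈ S, F x x z w = F x x x x + ∑ y ∈ S.erase x, (F x x x y + F x x y x +
      F x x y y + ∑ z ∈ (S.erase x).erase y, F x x y z) := by
    rw [sum_eq_add_sum_erase hx, sum_eq_add_sum_erase hx, add_assoc, ← Finset.sum_add_distrib]
    congr 1
    refine Finset.sum_congr rfl fun y hy => ?_
    rw [sum_eq_add_sum_erase hx, sum_eq_add_sum_erase hy]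
    ring
  rw [sum_eq_add_sum_erase hx, h₁, add_assoc, ← Finset.sum_add_distrib]
  congr 1
  refine Finset.sum_congr rfl fun y hy => ?_
  have h₂ : ∀ u ∈ S, ∑ w ∈ S, F x y u w = F x y u x + (F x y u y +
      ∑ z ∈ (S.erase x).erase y, F x y u z) := by
    intro u hu
    rw [sum_eq_add_sum_erase hx, sum_eq_add_sum_erase hy]
  have h₃ : ∀ z ∈ (S.erase x).erase y, ∑ w ∈ S, F x y z w = F x y z x + F x y z y + F x y z z +
      ∑ w ∈ ((S.erase x).erase y).erase z, F x y z w := by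
    intro z hz
    rw [h₂ z (Finset.mem_of_mem_erase (Finset.mem_of_mem_erase hz)), sum_eq_add_sum_erase hz]
    ring
  rw [sum_eq_add_sum_erase hx, sum_eq_add_sum_erase hy, h₂ x hx,
    h₂ y (Finset.mem_of_mem_erase hy), Finset.sum_congr rfl h₃]
  simp only [Finset.sum_add_distrib]
  ring

theorem sum_injective {α : Type*} [DecidableEq α] (S : Finset α) (F : α → α → α → α → ℤ) :
    ∑ z ∈ (Fintype.piFinset fun _ : Fin 4 => S).filter Function.Injective,
        F (z 0) (z 1) (z 2) (z 3) =
      ∑ x ∈ S, ∑ y ∈ S.erase x, ∑ z ∈ (S.erase x).erase y, ∑ w ∈ ((S.erase x).erase y).erase z,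
        F x y z w := by
  simp only [Finset.sum_sigma']
  refine Finset.sum_nbij' (fun z => ⟨z 0, z 1, z 2, z 3⟩)
    (fun p => ![p.1, p.2.1, p.2.2.1, p.2.2.2]) ?_ ?_ ?_ ?_ ?_
  · intro z hz
    rw [Finset.mem_filter, Fintype.mem_piFinset] at hz
    simp only [Finset.mem_sigma, Finset.mem_erase, hz.1, hz.2.ne_iff]
    decide
  · rintro ⟨x, y, z, w⟩ hp
    simp only [Finset.mem_sigma, Finset.mem_erase] at hp
    rw [Finset.mem_filter, Fintype.mem_piFinset]
    obtain ⟨hx, ⟨hyx, hy⟩, ⟨hzy, hzx, hz⟩, hwz, hwy, hwx, hw⟩ := hp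
    refine ⟨fun i => ?_, fun i j hij => ?_⟩
    · fin_cases i <;> assumption
    · fin_cases i <;> fin_cases j <;> simp_all
  · intro z _
    funext i
    fin_cases i <;> rfl
  · rintro ⟨x, y, z, w⟩ _
    rfl
  · intro z _
    rfl

theorem sum_injective_perm {α : Type*} [DecidableEq α] (S : Finset α) (G : (Fin 4 → α) → ℤ)
    (σ : Equiv.Perm (Fin 4)) :
    ∑ z ∈ (Fintype.piFinset fun _ : Fin 4 => S).filter Function.Injective, G (z ∘ σ) =
      ∑ z ∈ (Fintype.piFinset fun _ : Fin 4 => S).filter Function.Injective, G z := by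
  refine Finset.sum_equiv (Equiv.arrowCongr σ.symm (Equiv.refl α)) (fun z => ?_) fun z _ => rfl
  simp only [Finset.mem_filter, Fintype.mem_piFinset]
  refine and_congr ?_ (σ.injective_comp z).symm
  exact (Equiv.forall_congr_right σ (q := fun i => z i ∈ S)).symm

theorem sum_kernel_eq_sum_quadKernel {S : Finset (Fin 20 → Bool)} (hS : S.card = 257) :
    256 * 255 * 254 * ∑ x ∈ S, ∑ y ∈ S, ∑ z ∈ S, ∑ w ∈ S, kernel x y z w =
      ∑ z ∈ (Fintype.piFinset fun _ : Fin 4 => S).filter Function.Injective,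
        quadKernel (z 0) (z 1) (z 2) (z 3) := by
  rw [sum_quadruples, sum_injective, Finset.mul_sum]
  refine Finset.sum_congr rfl fun x hx => ?_
  have hx' : (S.erase x).card = 256 := by rw [Finset.card_erase_of_mem hx, hS]
  have hk : 256 * 255 * 254 * kernel x x x x = ∑ y ∈ S.erase x, 255 * 254 * kernel x x x x := by
    rw [Finset.sum_const, hx', nsmul_eq_mul]
    push_cast
    ring
  rw [mul_add, hk, Finset.mul_sum, ← Finset.sum_add_distrib]
  refine Finset.sum_congr rfl fun y hy => ?_
  have hy' : ((S.erase x).erase y).card = 255 := by rw [Finset.card_erase_of_mem hy, hx']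
  have hp : 255 * 254 * kernel x x x x + 256 * 255 * 254 * pairKernel x y =
      ∑ z ∈ (S.erase x).erase y, 254 * (kernel x x x x + 256 * pairKernel x y) := by
    rw [Finset.sum_const, hy', nsmul_eq_mul]
    push_cast
    ring
  rw [← pairKernel, mul_add, ← add_assoc, hp, Finset.mul_sum, ← Finset.sum_add_distrib]
  refine Finset.sum_congr rfl fun z hz => ?_
  have hz' : (((S.erase x).erase y).erase z).card = 254 := by
    rw [Finset.card_erase_of_mem hz, hy']
  have ht : 254 * degenerateKernel x y z = ∑ w ∈ ((S.erase x).erase y).erase z,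
      degenerateKernel x y z := by
    rw [Finset.sum_const, hz', nsmul_eq_mul]
    push_cast
    ring
  simp only [quadKernel]
  rw [Finset.sum_add_distrib, ← ht, ← Finset.mul_sum, degenerateKernel, tripleKernel]
  ring

theorem card_ne_of_isDistance {S : Finset (Fin 20 → Bool)}
    (hS : ∀ u ∈ S, ∀ v ∈ S, u ≠ v → isDistance (distance u v) = true) : S.card ≠ 257 := by
  intro hc
  have h₀ := sum_kernel_nonneg S
  have h₁ := sum_kernel_eq_sum_quadKernel hc
  have h₂ : ∑ z ∈ (Fintype.piFinset fun _ : Fin 4 => S).filter Function.Injective, quadSum z =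
      24 * ∑ z ∈ (Fintype.piFinset fun _ : Fin 4 => S).filter Function.Injective,
        quadKernel (z 0) (z 1) (z 2) (z 3) := by
    simp only [quadSum]
    rw [Finset.sum_comm]
    refine (Finset.sum_congr rfl fun σ _ => sum_injective_perm S
      (fun z => quadKernel (z 0) (z 1) (z 2) (z 3)) σ).trans ?_
    rw [Finset.sum_const, Finset.card_univ,
      Fintype.card_perm, Fintype.card_fin, nsmul_eq_mul]
    rfl
  have h₃ : ∑ z ∈ (Fintype.piFinset fun _ : Fin 4 => S).filter Function.Injective,
      quadSum z < 0 := by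
    refine Finset.sum_neg (fun z hz => ?_) ?_
    · rw [Finset.mem_filter, Fintype.mem_piFinset] at hz
      exact quadSum_neg z fun i j hij => hS _ (hz.1 i) _ (hz.1 j) (hz.2.ne hij)
    · obtain ⟨e⟩ : Nonempty (Fin 4 ↪ S) :=
        Function.Embedding.nonempty_of_card_le (by simp [hc])
      refine ⟨fun i => e i, Finset.mem_filter.2 ⟨Fintype.mem_piFinset.2 fun i => (e i).2, ?_⟩⟩
      exact Subtype.val_injective.comp e.injective
  linarith

/-- The word `x` with its first letter replaced by the parity of the other letters. -/
def evenWord (x : Fin 20 → Bool) : Fin 20 → Bool :=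
  Fin.cons (α := fun _ => Bool)
    (decide ((Finset.univ.filter fun i : Fin 19 => x i.succ = true).card % 2 = 1)) fun i => x i.succ

theorem even_trueCount_evenWord (x : Fin 20 → Bool) :
    Even (trueCount Finset.univ (evenWord x)) := by
  rw [trueCount, Fin.card_filter_univ_succ]
  simp only [evenWord, Fin.cons_zero, Fin.cons_succ, decide_eq_true_eq, Nat.even_iff]
  split_ifs <;> omega

theorem even_distance_evenWord (x y : Fin 20 → Bool) :
    Even (distance (evenWord x) (evenWord y)) := by
  rw [← neg_one_pow_eq_one_iff_even (R := ℤ) (by decide), distance, ← character_eq,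
    ← character_mul, character_eq, character_eq, (even_trueCount_evenWord x).neg_one_pow,
    (even_trueCount_evenWord y).neg_one_pow, mul_one]

theorem distance_le_distance_evenWord (x y : Fin 20 → Bool) :
    distance x y ≤ distance (evenWord x) (evenWord y) + 1 := by
  have h : ∀ i : Fin 19, differ (evenWord x) (evenWord y) i.succ = differ x y i.succ :=
    fun _ => rfl
  rw [distance, distance, trueCount, trueCount, Fin.card_filter_univ_succ,
    Fin.card_filter_univ_succ fun i => differ (evenWord x) (evenWord y) i = true]
  simp only [h]
  split_ifs <;> omega

theorem hammingDist_eq_distance (x y : Fin 20 → Bool) : hammingDist x y = distance x y := by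
  unfold hammingDist distance trueCount
  congr 1
  refine Finset.filter_congr fun i _ => ?_
  rw [differ, ne_eq, bne_iff_ne]

theorem card_le_of_hammingDist {C : Finset (Fin 20 → Bool)}
    (hC : ∀ u ∈ C, ∀ v ∈ C, u ≠ v → 8 ≤ hammingDist u v) : C.card ≤ 256 := by
  by_contra! h
  obtain ⟨S, hSC, hS⟩ := Finset.exists_subset_card_eq h
  have hd : ∀ u ∈ S, ∀ v ∈ S, u ≠ v → isDistance (distance (evenWord u) (evenWord v)) = true := by
    intro u hu v hv huv
    have h₁ := hC u (hSC hu) v (hSC hv) huv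
    have h₂ := distance_le_distance_evenWord u v
    have h₃ := Nat.even_iff.1 (even_distance_evenWord u v)
    rw [hammingDist_eq_distance] at h₁
    rw [isDistance, h₃, Nat.ble_eq_true_of_le (by omega)]
    rfl
  have hinj : Set.InjOn evenWord S := by
    intro u hu v hv huv
    by_contra hne
    have h' := hd u hu v hv hne
    rw [huv, distance_self] at h'
    exact absurd h' (by decide)
  refine card_ne_of_isDistance (S := S.image evenWord) ?_
    ((Finset.card_image_of_injOn hinj).trans hS)
  intro u hu v hv huv
  obtain ⟨u', hu', rfl⟩ := Finset.mem_image.1 hu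
  obtain ⟨v', hv', rfl⟩ := Finset.mem_image.1 hv
  exact hd u' hu' v' hv' fun h => huv (congrArg evenWord h)

/-- The codewords of the quadruply shortened Golay code. -/
def codeword (c : Fin 8 → Bool) (i : Fin 20) : Bool :=
  (List.finRange 8).foldr (fun j b => xor (c j && Nat.testBit (nth 0
    [255, 3855, 13107, 21845, 38505, 197462, 329059, 591418] j) i) b) false

theorem foldr_xor {α : Type*} (l : List α) (c c' f : α → Bool) :
    xor (l.foldr (fun j b => xor (c j && f j) b) false)
        (l.foldr (fun j b => xor (c' j && f j) b) false) =
      l.foldr (fun j b => xor (xor (c j) (c' j) && f j) b) false := by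
  induction l with
  | nil => rfl
  | cons j l ih =>
    rw [List.foldr_cons, List.foldr_cons, List.foldr_cons, ← ih, Bool.and_xor_distrib_right]
    simp only [Bool.xor_assoc, Bool.xor_left_comm]

theorem differ_codeword (c c' : Fin 8 → Bool) :
    differ (codeword c) (codeword c') = codeword fun j => xor (c j) (c' j) :=
  funext fun _ => foldr_xor ..

theorem eight_le_distance_codeword {c c' : Fin 8 → Bool} (h : c ≠ c') :
    8 ≤ distance (codeword c) (codeword c') := by
  have hw : ∀ c : Fin 8 → Bool, (∃ j, c j = true) → 8 ≤ trueCount Finset.univ (codeword c) := by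
    decide +kernel
  rw [distance, differ_codeword]
  obtain ⟨j, hj⟩ := Function.ne_iff.1 h
  exact hw _ ⟨j, bne_iff_ne.2 hj⟩

/-- `A(20,8) = 256`: the maximum cardinality of a binary code of length 20 in which
any two distinct codewords have Hamming distance at least 8 is exactly 256. -/
theorem A_20_8_eq_256 :
    IsGreatest {k : ℕ | ∃ C : Finset (Fin 20 → Bool),
      (∀ u ∈ C, ∀ v ∈ C, u ≠ v → 8 ≤ hammingDist u v) ∧ C.card = k} 256 := by
  refine ⟨⟨Finset.univ.image codeword, ?_, ?_⟩, ?_⟩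
  · intro u hu v hv huv
    obtain ⟨c, -, rfl⟩ := Finset.mem_image.1 hu
    obtain ⟨c', -, rfl⟩ := Finset.mem_image.1 hv
    rw [hammingDist_eq_distance]
    exact eight_le_distance_codeword fun h => huv (congrArg codeword h)
  · rw [Finset.card_image_of_injective]
    · simp
    · intro c c' h
      by_contra hne
      have h' := eight_le_distance_codeword hne
      rw [h, distance_self] at h'
      omega
  · rintro k ⟨C, hC, rfl⟩
    exact card_le_of_hammingDist hC
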